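/- arXiv:1909.01260 — 5 statements merged into one kernel-verified Lean document; each statement's English description precedes it below -/
import Mathlib

section
/- Let n and k be positive integers and let G be a k-regular simple graph on the vertex set {0, 1, ..., 2n−1}. If the sum of sign(𝓕) over all ordered 1-factorizations 𝓕 = (F_1, ..., F_k) of G is nonzero, then G is k-list-edge-colorable. -/
open scoped Classical

/-- Two edges `e = {a,c}` and `f = {b,d}` (with `a < c`, `b < d`) of a graph on
`{0, …, m-1}` *cross* (intersect) if `a < b < c < d`.  For an unordered pair of
distinct matching edges that intersect in the sense of Schauz, exactly one of
`crosses e f`, `crosses f e` holds. -/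
def crosses {m : ℕ} (e f : Sym2 (Fin m)) : Prop :=
  ∃ a b c d : Fin m, e = s(a, c) ∧ f = s(b, d) ∧ a < b ∧ b < c ∧ c < d

/-- `sign F = (-1)^{int F}` where `int F` is the number of unordered pairs of
intersecting edges of `F`. -/
noncomputable def matchingSign {m : ℕ} (F : Finset (Sym2 (Fin m))) : ℤ :=
  (-1) ^ (Finset.filter (fun p : Sym2 (Fin m) × Sym2 (Fin m) => crosses p.1 p.2)
      (F ×ˢ F)).card

/-- `F` is (the edge set of) a perfect matching of `G`: every edge of `F` is an
edge of `G` and every vertex lies in exactly one edge of `F`. -/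
def IsPerfectMatchingOf {m : ℕ} (G : SimpleGraph (Fin m))
    (F : Finset (Sym2 (Fin m))) : Prop :=
  (∀ e ∈ F, e ∈ G.edgeSet) ∧ ∀ v : Fin m, ∃! e, e ∈ F ∧ v ∈ e

/-- An ordered 1-factorization `𝓕 = (F_1, …, F_k)` of `G`: each `F_i` is a
perfect matching of `G`, and the `F_i` partition the edge set of `G`. -/
def IsOrderedOneFactorization {m k : ℕ} (G : SimpleGraph (Fin m))
    (𝓕 : Fin k → Finset (Sym2 (Fin m))) : Prop :=
  (∀ i, IsPerfectMatchingOf G (𝓕 i)) ∧ ∀ e, e ∈ G.edgeSet ↔ ∃! i, e ∈ 𝓕 i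

/-- The sum of `sign 𝓕 = sign (F_1) ⋯ sign (F_k)` over all ordered
1-factorizations `𝓕` of `G`. -/
noncomputable def factorizationSignSum {m : ℕ} (k : ℕ) (G : SimpleGraph (Fin m)) : ℤ :=
  ∑ 𝓕 ∈ Finset.filter
      (fun 𝓕 : Fin k → Finset (Sym2 (Fin m)) => IsOrderedOneFactorization G 𝓕)
      Finset.univ,
    ∏ i : Fin k, matchingSign (𝓕 i)

/-- `G` is `k`-list-edge-colorable: for every assignment of a finite list of at
least `k` colors to each edge there is a proper edge coloring choosing each
edge's color from its list. -/
def ListEdgeColorable {V : Type} (G : SimpleGraph V) (k : ℕ) : Prop :=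
  ∀ (α : Type) (L : Sym2 V → Finset α), (∀ e ∈ G.edgeSet, k ≤ (L e).card) →
    ∃ c : Sym2 V → α, (∀ e ∈ G.edgeSet, c e ∈ L e) ∧
      ∀ e₁ ∈ G.edgeSet, ∀ e₂ ∈ G.edgeSet, e₁ ≠ e₂ → (∃ v, v ∈ e₁ ∧ v ∈ e₂) →
        c e₁ ≠ c e₂

namespace ListEdgeColoring

/-- A relation that is the strict part of a tournament: it is irreflexive, and of two distinct
elements exactly one is related to the other. -/
structure IsTournament {D : Type*} (R : D → D → Prop) : Prop where
  irrefl : ∀ x, ¬ R x x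
  asymm : ∀ x y, R x y → ¬ R y x
  total : ∀ x y, x ≠ y → R x y ∨ R y x

/-- The product of `f x y` over all pairs with `R x y`. -/
noncomputable def pairProd {D : Type*} [Fintype D] (R : D → D → Prop) (f : D → D → ℤ) : ℤ :=
  ∏ p : D × D with R p.1 p.2, f p.1 p.2

/-- The antisymmetric sign function of a relation. -/
noncomputable def relSign {D : Type*} (R : D → D → Prop) (x y : D) : ℤ := if R x y then 1 else -1

section Tournament

variable {D D' : Type*}

theorem IsTournament.relSign_symm {R : D → D → Prop} (hR : IsTournament R) {x y : D}
    (h : x ≠ y) : relSign R y x = - relSign R x y := by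
  unfold relSign
  have := hR.asymm x y
  have := hR.total x y h
  by_cases h1 : R x y <;> simp_all

theorem relSign_ne_zero (R : D → D → Prop) (x y : D) : relSign R x y ≠ 0 := by
  unfold relSign; split_ifs <;> simp

theorem relSign_mul_self (R : D → D → Prop) (x y : D) : relSign R x y * relSign R x y = 1 := by
  unfold relSign; split_ifs <;> simp

variable [Fintype D] [Fintype D']

theorem pairProd_eq_of_symm {R S : D → D → Prop} (hR : IsTournament R) (hS : IsTournament S)
    {f : D → D → ℤ} (hf : ∀ x y, x ≠ y → f x y = f y x) : pairProd R f = pairProd S f := by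
  have aux : ∀ {R S : D → D → Prop}, IsTournament R → IsTournament S → ∀ p : D × D, R p.1 p.2 →
      (if R (if S p.1 p.2 then p else p.swap).1 (if S p.1 p.2 then p else p.swap).2
        then (if S p.1 p.2 then p else p.swap)
        else (if S p.1 p.2 then p else p.swap).swap) = p := by
    rintro R S hR hS ⟨x, y⟩ h
    have h' := hR.asymm x y h
    by_cases hs : S x y <;> simp_all
  have aux' : ∀ {R S : D → D → Prop}, IsTournament R → IsTournament S → ∀ p : D × D, R p.1 p.2 →
      S (if S p.1 p.2 then p else p.swap).1 (if S p.1 p.2 then p else p.swap).2 := by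
    rintro R S hR hS ⟨x, y⟩ h
    have hne : x ≠ y := by rintro rfl; exact hR.irrefl _ h
    by_cases hs : S x y
    · simp [hs]
    · simpa [hs] using (hS.total x y hne).resolve_left hs
  unfold pairProd
  refine Finset.prod_nbij' (fun p => if S p.1 p.2 then p else p.swap)
    (fun p => if R p.1 p.2 then p else p.swap) ?_ ?_ ?_ ?_ ?_
  · intro p hp
    simpa using aux' hR hS p (by simpa using hp)
  · intro p hp
    simpa using aux' hS hR p (by simpa using hp)
  · intro p hp
    exact aux hR hS p (by simpa using hp)
  · intro p hp
    exact aux hS hR p (by simpa using hp)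
  · rintro ⟨x, y⟩ hp
    have hne : x ≠ y := by rintro rfl; exact hR.irrefl x (by simpa using hp)
    by_cases hs : S x y
    · simp [hs]
    · simpa [hs] using hf x y hne

theorem pairProd_mul (R : D → D → Prop) (f g : D → D → ℤ) :
    pairProd R (fun x y => f x y * g x y) = pairProd R f * pairProd R g :=
  Finset.prod_mul_distrib

theorem pairProd_congr (R : D → D → Prop) {f g : D → D → ℤ} (h : ∀ x y, R x y → f x y = g x y) :
    pairProd R f = pairProd R g :=
  Finset.prod_congr rfl fun p hp => h p.1 p.2 (by simpa using hp)

theorem pairProd_ne_zero (R : D → D → Prop) {f : D → D → ℤ} (h : ∀ x y, R x y → f x y ≠ 0) :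
    pairProd R f ≠ 0 :=
  Finset.prod_ne_zero_iff.2 fun p hp => h p.1 p.2 (by simpa using hp)

theorem pairProd_comap (e : D ≃ D') (R : D' → D' → Prop) (f : D' → D' → ℤ) :
    pairProd (fun x y => R (e x) (e y)) (fun x y => f (e x) (e y)) = pairProd R f := by
  unfold pairProd
  refine Finset.prod_equiv (e.prodCongr e) ?_ ?_ <;> simp

/-- Transporting a product of an antisymmetric function from one tournament to another. -/
theorem pairProd_mul_relSign {R S : D → D → Prop} (hR : IsTournament R) (hS : IsTournament S)
    {f : D → D → ℤ} (hf : ∀ x y, x ≠ y → f y x = - f x y) :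
    pairProd R f = pairProd S f * pairProd S (relSign R) := by
  rw [← pairProd_mul, ← pairProd_eq_of_symm hR hS]
  · exact pairProd_congr R fun x y h => by simp [relSign, h]
  · intro x y h
    simp only [hf x y h, hR.relSign_symm h]
    ring

end Tournament

/-- A loopless multigraph on a linearly ordered vertex set, each edge `e` joining `lo e` and
`hi e`, with at most one edge for every pair of endpoints. -/
structure OrderedEdges (E V : Type*) [LinearOrder V] where
  lo : E → V
  hi : E → V
  lo_lt_hi : ∀ e, lo e < hi e
  inj : ∀ e f, lo e = lo f → hi e = hi f → e = f

namespace OrderedEdges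

variable {E V : Type*} [LinearOrder V] (H : OrderedEdges E V)

/-- The vertex at which a half-edge is attached. -/
def vert (x : E × Bool) : V := if x.2 then H.hi x.1 else H.lo x.1

/-- The vertex opposite to the one at which a half-edge is attached. -/
def opp (x : E × Bool) : V := if x.2 then H.lo x.1 else H.hi x.1

theorem vert_opp_inj {x y : E × Bool} (h1 : H.vert x = H.vert y) (h2 : H.opp x = H.opp y) :
    x = y := by
  obtain ⟨e, b⟩ := x
  obtain ⟨f, b'⟩ := y
  have := H.lo_lt_hi e
  have := H.lo_lt_hi f
  cases b <;> cases b' <;> simp only [vert, opp, if_true, if_false, Bool.false_eq_true] at h1 h2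
  · rw [H.inj e f h1 h2]
  · order
  · order
  · rw [H.inj e f h2 h1]

/-- Half-edges ordered by vertex, then by opposite vertex. -/
def vertOppLT (x y : E × Bool) : Prop := toLex (H.vert x, H.opp x) < toLex (H.vert y, H.opp y)

/-- Half-edges ordered by edge, then by vertex. -/
def edgeLT (x y : E × Bool) : Prop :=
  toLex (H.lo x.1, toLex (H.hi x.1, x.2)) < toLex (H.lo y.1, toLex (H.hi y.1, y.2))

theorem isTournament_of_injective {D T : Type*} [LinearOrder T] {κ : D → T}
    (hκ : Function.Injective κ) : IsTournament (fun x y => κ x < κ y) where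
  irrefl _ := lt_irrefl _
  asymm _ _ h := h.asymm
  total _ _ h := lt_or_gt_of_ne (hκ.ne h)

theorem isTournament_vertOppLT : IsTournament H.vertOppLT :=
  isTournament_of_injective (κ := fun x => toLex (H.vert x, H.opp x)) fun x y h => by
    simp only [EmbeddingLike.apply_eq_iff_eq, Prod.mk.injEq] at h
    exact H.vert_opp_inj h.1 h.2

theorem isTournament_edgeLT : IsTournament H.edgeLT :=
  isTournament_of_injective
    (κ := fun x : E × Bool => toLex (H.lo x.1, toLex (H.hi x.1, x.2)))
    fun x y h => by
      simp only [EmbeddingLike.apply_eq_iff_eq, Prod.mk.injEq] at h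
      exact Prod.ext (H.inj _ _ h.1 h.2.1) h.2.2

/-- Two edges cross if their endpoints interlace, the first one starting first. -/
def Cross (e f : E) : Prop := H.lo e < H.lo f ∧ H.lo f < H.hi e ∧ H.hi e < H.hi f

variable {k : ℕ} (c : E → Fin k)

/-- An edge coloring is proper if at every vertex each color appears at most once. -/
def Proper : Prop := ∀ x y, H.vert x = H.vert y → c x.1 = c y.1 → x = y

/-- Half-edges ordered by vertex, then by color. -/
def vertColorLT (x y : E × Bool) : Prop := toLex (H.vert x, c x.1) < toLex (H.vert y, c y.1)

/-- Half-edges ordered by color, then by vertex. -/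
def colorVertLT (x y : E × Bool) : Prop := toLex (c x.1, H.vert x) < toLex (c y.1, H.vert y)

/-- Half-edges ordered by color, then by edge, then by vertex. -/
def colorEdgeLT (x y : E × Bool) : Prop :=
  toLex (c x.1, toLex (H.lo x.1, x.2)) < toLex (c y.1, toLex (H.lo y.1, y.2))

/-- The local factor at a pair of half-edges: the color difference if they share their vertex,
and otherwise the sign given by the order of their vertices. -/
def localFactor (p q : V × Fin k) : ℤ :=
  if p.1 = q.1 then ((q.2 : ℕ) : ℤ) - ((p.2 : ℕ) : ℤ) else if p.1 < q.1 then 1 else -1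

/-- Colored vertices ordered by vertex, then by color. -/
def lexLT (p q : V × Fin k) : Prop := toLex p < toLex q

/-- Colored vertices ordered by color, then by vertex. -/
def colexLT (p q : V × Fin k) : Prop := toLex p.swap < toLex q.swap

theorem localFactor_symm (p q : V × Fin k) :
    localFactor q p = - localFactor p q := by
  unfold localFactor
  by_cases h1 : p.1 = q.1
  · simp [h1]
  · rcases lt_or_gt_of_ne h1 with h2 | h2
    · simp [h1, Ne.symm h1, h2, h2.asymm]
    · simp [h1, Ne.symm h1, h2, h2.asymm]

theorem localFactor_ne_zero (p q : V × Fin k) (h : p ≠ q) : localFactor p q ≠ 0 := by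
  unfold localFactor
  split_ifs with h1 h2
  · intro h3
    exact h (Prod.ext h1 (Fin.ext (by omega)))
  · simp
  · simp

theorem edgeLT_iff {x y : E × Bool} (h : x.1 ≠ y.1) :
    H.edgeLT x y ↔ H.lo x.1 < H.lo y.1 ∨ H.lo x.1 = H.lo y.1 ∧ H.hi x.1 < H.hi y.1 := by
  have := H.inj x.1 y.1
  simp only [edgeLT, Prod.Lex.toLex_lt_toLex]
  grind

variable {H c} in
theorem Proper.lo_ne (hc : H.Proper c) {e f : E} (h : e ≠ f) (hef : c e = c f) :
    H.lo e ≠ H.lo f := fun h' =>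
  h (congrArg Prod.fst (hc (e, false) (f, false) (by simpa [vert] using h') hef))

variable {H c} in
theorem Proper.hi_ne (hc : H.Proper c) {e f : E} (h : e ≠ f) (hef : c e = c f) :
    H.hi e ≠ H.hi f := fun h' =>
  h (congrArg Prod.fst (hc (e, true) (f, true) (by simpa [vert] using h') hef))

variable {H c} in
theorem Proper.lo_ne_hi (hc : H.Proper c) {e f : E} (hef : c e = c f) :
    H.lo e ≠ H.hi f := fun h' => by
  simpa using congrArg Prod.snd (hc (e, false) (f, true) (by simpa [vert] using h') hef)

variable {H c} in
theorem Proper.colorEdgeLT_iff (hc : H.Proper c) {x y : E × Bool} (h : x.1 ≠ y.1) :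
    H.colorEdgeLT c x y ↔ c x.1 < c y.1 ∨ c x.1 = c y.1 ∧ H.lo x.1 < H.lo y.1 := by
  have := hc.lo_ne h
  simp only [colorEdgeLT, Prod.Lex.toLex_lt_toLex]
  grind

variable {H c} in
theorem Proper.injective (hc : H.Proper c) :
    Function.Injective fun x : E × Bool => (H.vert x, c x.1) := fun x y h =>
  hc x y (congrArg Prod.fst h) (congrArg Prod.snd h)

theorem isTournament_colorVertLT (hc : H.Proper c) : IsTournament (H.colorVertLT c) :=
  isTournament_of_injective (κ := fun x : E × Bool => toLex (c x.1, H.vert x)) fun x y h => by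
    simp only [EmbeddingLike.apply_eq_iff_eq, Prod.mk.injEq] at h
    exact hc x y h.2 h.1

theorem isTournament_vertColorLT (hc : H.Proper c) : IsTournament (H.vertColorLT c) :=
  isTournament_of_injective (κ := fun x : E × Bool => toLex (H.vert x, c x.1)) fun x y h => by
    simp only [EmbeddingLike.apply_eq_iff_eq, Prod.mk.injEq] at h
    exact hc x y h.1 h.2

theorem isTournament_colorEdgeLT (hc : H.Proper c) : IsTournament (H.colorEdgeLT c) :=
  isTournament_of_injective
    (κ := fun x : E × Bool => toLex (c x.1, toLex (H.lo x.1, x.2))) fun x y h => by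
      simp only [EmbeddingLike.apply_eq_iff_eq, Prod.mk.injEq] at h
      by_contra hne
      exact hc.lo_ne (fun h' => hne (Prod.ext h' h.2.2)) h.1 h.2.1

variable [Fintype E]

theorem pairProd_edgeLT_relSign_colorEdgeLT (hc : H.Proper c) :
    pairProd H.edgeLT (relSign (H.colorEdgeLT c)) = 1 := by
  unfold pairProd
  refine Finset.prod_involution
    (fun p _ => if p.1.1 = p.2.1 then p else (p.1, (p.2.1, !p.2.2))) ?_ ?_ ?_ ?_
  · rintro ⟨x, y⟩ -
    by_cases h : x.1 = y.1
    · simp only [h, if_true]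
      exact relSign_mul_self _ _ _
    · have : relSign (H.colorEdgeLT c) x (y.1, !y.2) = relSign (H.colorEdgeLT c) x y := by
        simp only [relSign, hc.colorEdgeLT_iff h,
          hc.colorEdgeLT_iff (x := x) (y := (y.1, !y.2)) h]
      simp only [h, if_false, this]
      exact relSign_mul_self _ _ _
  · rintro ⟨⟨e, b⟩, ⟨f, b'⟩⟩ hp h1
    by_cases h : e = f
    · subst h
      refine absurd ?_ h1
      simp_all [edgeLT, colorEdgeLT, Prod.Lex.toLex_lt_toLex, relSign]
    · simp [h]
  · rintro ⟨x, y⟩ hp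
    by_cases h : x.1 = y.1
    · simpa [h] using hp
    · have h2 := H.edgeLT_iff h
      have h3 := H.edgeLT_iff (x := x) (y := (y.1, !y.2)) h
      simp only [h, if_false, Finset.mem_filter, Finset.mem_univ, true_and] at hp ⊢
      exact h3.2 (h2.1 hp)
  · rintro ⟨x, y⟩ hp
    by_cases h : x.1 = y.1 <;> simp [h]

theorem pairProd_colorEdgeLT_relSign_colorVertLT (hc : H.Proper c) :
    pairProd (H.colorEdgeLT c) (relSign (H.colorVertLT c)) =
      ∏ e, ∏ f, if c e = c f ∧ H.Cross e f then -1 else 1 := by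
  unfold pairProd
  rw [Finset.prod_filter]
  simp only [Fintype.prod_prod_type]
  refine Finset.prod_congr rfl fun e _ => ?_
  rw [Finset.prod_comm' (t' := Finset.univ) (s' := fun _ => Finset.univ) (by simp)]
  refine Finset.prod_congr rfl fun f _ => ?_
  have h1 := H.lo_lt_hi e
  have h2 := H.lo_lt_hi f
  simp only [Fintype.prod_bool, relSign, colorEdgeLT, colorVertLT, Prod.Lex.toLex_lt_toLex,
    vert, if_true, if_false, Bool.false_eq_true, lt_irrefl, Cross, Bool.false_lt_true,
    and_true, and_false, or_false]
  rcases lt_trichotomy (c e) (c f) with h | h | h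
  · simp [h, h.ne]
  · by_cases hef : e = f
    · subst hef
      simp [h1]
    · have a1 := hc.lo_ne hef h
      have a2 := hc.hi_ne hef h
      have a3 := hc.lo_ne_hi h
      have a4 := hc.lo_ne_hi h.symm
      simp only [h, lt_irrefl, a1, true_and, false_or, false_and, or_false]
      rcases lt_or_gt_of_ne a1 with b | b
      · rcases lt_or_gt_of_ne a2 with b2 | b2 <;> rcases lt_or_gt_of_ne a4 with b4 | b4 <;>
        simp [b, b2, b4, b2.asymm, b4.asymm, b.trans h2]
        all_goals order
      · simp [b.asymm]
  · simp [h.asymm, h.ne']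

/-- The sign of an edge coloring: the parity of the number of crossing monochromatic pairs. -/
noncomputable def crossSign : ℤ := ∏ e, ∏ f, if c e = c f ∧ H.Cross e f then -1 else 1

theorem crossSign_mul_self : H.crossSign c * H.crossSign c = 1 := by
  simp only [crossSign, ← Finset.prod_mul_distrib]
  refine Finset.prod_eq_one fun e _ => Finset.prod_eq_one fun f _ => ?_
  split_ifs <;> simp

theorem pairProd_edgeLT_relSign_colorVertLT (hc : H.Proper c) :
    pairProd H.edgeLT (relSign (H.colorVertLT c)) = H.crossSign c := by
  have h := pairProd_mul_relSign (H.isTournament_colorEdgeLT c hc) H.isTournament_edgeLT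
    (f := relSign (H.colorVertLT c)) fun x y hxy =>
      (H.isTournament_colorVertLT c hc).relSign_symm hxy
  rw [H.pairProd_edgeLT_relSign_colorEdgeLT c hc, mul_one,
    H.pairProd_colorEdgeLT_relSign_colorVertLT c hc] at h
  exact h.symm

/-- The graph polynomial of the line graph, as a product of Vandermonde products. -/
noncomputable def linePoly : MvPolynomial E ℤ :=
  ∏ p : (E × Bool) × (E × Bool) with H.vert p.1 = H.vert p.2 ∧ H.opp p.1 < H.opp p.2,
    (MvPolynomial.X p.2.1 - MvPolynomial.X p.1.1)

theorem eval_linePoly_ne_zero {s : E → ℤ} (h : MvPolynomial.eval s H.linePoly ≠ 0)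
    {x y : E × Bool} (hxy : x ≠ y) (hv : H.vert x = H.vert y) : s x.1 ≠ s y.1 := by
  simp only [linePoly, map_prod, map_sub, MvPolynomial.eval_X, Finset.prod_ne_zero_iff,
    Finset.mem_filter, Finset.mem_univ, true_and, Prod.forall, sub_ne_zero] at h
  rcases lt_trichotomy (H.opp x) (H.opp y) with ho | ho | ho
  · exact (h x.1 x.2 y.1 y.2 ⟨hv, ho⟩).symm
  · exact absurd (H.vert_opp_inj hv ho) hxy
  · exact h y.1 y.2 x.1 x.2 ⟨hv.symm, ho⟩

theorem eval_linePoly_color :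
    MvPolynomial.eval (fun e => ((c e : ℕ) : ℤ)) H.linePoly =
      pairProd H.vertOppLT (fun x y => localFactor (H.vert x, c x.1) (H.vert y, c y.1)) := by
  simp only [linePoly, pairProd, map_prod, map_sub, MvPolynomial.eval_X]
  rw [Finset.prod_filter, Finset.prod_filter]
  refine Finset.prod_congr rfl fun p _ => ?_
  simp only [vertOppLT, Prod.Lex.toLex_lt_toLex, localFactor]
  by_cases h : H.vert p.1 = H.vert p.2
  · simp [h]
  · by_cases h' : H.vert p.1 < H.vert p.2 <;> simp [h, h']

theorem eval_linePoly_eq_zero (hc : ¬ H.Proper c) :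
    MvPolynomial.eval (fun e => ((c e : ℕ) : ℤ)) H.linePoly = 0 := by
  by_contra h
  refine hc fun x y hv hcol => ?_
  by_contra hxy
  exact H.eval_linePoly_ne_zero h hxy hv (by rw [hcol])

variable [Fintype V]

/-- The constant relating the graph polynomial to crossing signs. -/
noncomputable def signConst (k : ℕ) : ℤ :=
  pairProd H.edgeLT (relSign H.vertOppLT) *
    pairProd lexLT fun p q : V × Fin k => localFactor p q * relSign colexLT p q

theorem signConst_ne_zero (k : ℕ) : H.signConst k ≠ 0 := by
  refine mul_ne_zero (pairProd_ne_zero _ fun x y _ => relSign_ne_zero _ _ _)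
    (pairProd_ne_zero _ fun p q h => mul_ne_zero (localFactor_ne_zero p q ?_)
      (relSign_ne_zero _ _ _))
  rintro rfl
  exact lt_irrefl _ h

theorem pairProd_localFactor (hc : H.Proper c)
    (hcard : Fintype.card E * 2 = Fintype.card V * k) :
    pairProd H.vertOppLT (fun x y => localFactor (H.vert x, c x.1) (H.vert y, c y.1)) =
      H.signConst k * H.crossSign c := by
  set g : E × Bool → E × Bool → ℤ :=
    fun x y => localFactor (H.vert x, c x.1) (H.vert y, c y.1) with hg
  have hgs : ∀ x y, x ≠ y → g y x = - g x y := fun x y _ => localFactor_symm _ _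
  have hbij : Function.Bijective fun x : E × Bool => (H.vert x, c x.1) :=
    (Fintype.bijective_iff_injective_and_card _).2 ⟨hc.injective, by simpa using hcard⟩
  have hK : pairProd (H.vertColorLT c) (fun x y => g x y * relSign (H.colorVertLT c) x y) =
      pairProd lexLT fun p q : V × Fin k => localFactor p q * relSign colexLT p q :=
    pairProd_comap (Equiv.ofBijective _ hbij) lexLT
      fun p q : V × Fin k => localFactor p q * relSign colexLT p q
  have h1 := pairProd_mul_relSign H.isTournament_vertOppLT H.isTournament_edgeLT hgs
  have h2 : pairProd (H.vertColorLT c) (fun x y => g x y * relSign (H.colorVertLT c) x y) =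
      pairProd H.edgeLT g * H.crossSign c := by
    rw [← H.pairProd_edgeLT_relSign_colorVertLT c hc, ← pairProd_mul]
    refine pairProd_eq_of_symm (H.isTournament_vertColorLT c hc) H.isTournament_edgeLT
      fun x y hxy => ?_
    rw [hgs x y hxy, (H.isTournament_colorVertLT c hc).relSign_symm hxy]
    ring
  rw [h1, signConst, ← hK, h2]
  linear_combination (-(pairProd H.edgeLT g * pairProd H.edgeLT (relSign H.vertOppLT))) *
    H.crossSign_mul_self c

variable {H c}

theorem Proper.bijective (hc : H.Proper c) (hcard : Fintype.card E * 2 = Fintype.card V * k) :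
    Function.Bijective fun x : E × Bool => (H.vert x, c x.1) :=
  (Fintype.bijective_iff_injective_and_card _).2 ⟨hc.injective, by simpa using hcard⟩

theorem Proper.card_vert_fiber (hc : H.Proper c)
    (hcard : Fintype.card E * 2 = Fintype.card V * k) (v : V) :
    (Finset.univ.filter fun x => H.vert x = v).card = k := by
  rw [← Finset.card_fin k]
  refine Finset.card_nbij (fun x => c x.1) (by simp) ?_ ?_
  · intro x hx y hy h
    simp only [Finset.coe_filter, Finset.mem_univ, true_and, Set.mem_ofPred_eq] at hx hy
    exact hc x y (hx.trans hy.symm) h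
  · intro i _
    obtain ⟨x, hx⟩ := (hc.bijective hcard).2 (v, i)
    exact ⟨x, by simpa using congrArg Prod.fst hx, congrArg Prod.snd hx⟩

theorem Proper.card_color_fiber (hc : H.Proper c)
    (hcard : Fintype.card E * 2 = Fintype.card V * k) (i : Fin k) :
    (Finset.univ.filter fun e => c e = i).card * 2 = Fintype.card V := by
  have h : ((Finset.univ.filter fun e => c e = i) ×ˢ (Finset.univ : Finset Bool)).card =
      (Finset.univ : Finset V).card := by
    refine Finset.card_nbij H.vert (by simp) ?_ ?_
    · intro x hx y hy h
      simp only [Finset.coe_product, Finset.coe_filter, Finset.mem_univ, true_and, Set.mem_prod,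
        Set.mem_ofPred_eq] at hx hy
      exact hc x y h (hx.1.trans hy.1.symm)
    · intro v _
      obtain ⟨x, hx⟩ := (hc.bijective hcard).2 (v, i)
      exact ⟨x, by simpa using congrArg Prod.snd hx, congrArg Prod.fst hx⟩
  simpa using h

theorem Proper.isHomogeneous_linePoly (hc : H.Proper c)
    (hcard : Fintype.card E * 2 = Fintype.card V * k) :
    H.linePoly.IsHomogeneous (Fintype.card E * (k - 1)) := by
  have h : H.linePoly.IsHomogeneous
      (∑ p : (E × Bool) × (E × Bool) with H.vert p.1 = H.vert p.2 ∧ H.opp p.1 < H.opp p.2,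
        1) :=
    MvPolynomial.IsHomogeneous.prod _ _ _ fun p _ =>
      (MvPolynomial.isHomogeneous_X _ _).sub (MvPolynomial.isHomogeneous_X _ _)
  convert h using 1
  have hswap : ∑ p : (E × Bool) × (E × Bool), (if H.vert p.1 = H.vert p.2 ∧
      H.opp p.2 < H.opp p.1 then 1 else 0) = ∑ p : (E × Bool) × (E × Bool),
      (if H.vert p.1 = H.vert p.2 ∧ H.opp p.1 < H.opp p.2 then 1 else 0) := by
    rw [← (Equiv.prodComm _ _).sum_comp]
    simp only [Equiv.prodComm_apply, Prod.fst_swap, Prod.snd_swap, eq_comm]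
  have hsum : ∑ p : (E × Bool) × (E × Bool), (if H.vert p.1 = H.vert p.2 ∧ p.1 ≠ p.2
      then 1 else 0) = Fintype.card E * 2 * (k - 1) := by
    rw [Fintype.sum_prod_type]
    have : ∀ x : E × Bool, ∑ y : E × Bool, (if H.vert x = H.vert y ∧ x ≠ y then 1 else 0) =
        k - 1 := fun x => by
      rw [← Finset.card_filter, ← hc.card_vert_fiber hcard (H.vert x),
        ← Finset.card_erase_of_mem (a := x) (by simp)]
      congr 1
      ext y
      simp only [Finset.mem_filter, Finset.mem_univ, true_and, Finset.mem_erase]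
      grind
    simp [this]
  have hsplit : ∑ p : (E × Bool) × (E × Bool), (if H.vert p.1 = H.vert p.2 ∧ p.1 ≠ p.2
      then 1 else 0) = ∑ p : (E × Bool) × (E × Bool), (if H.vert p.1 = H.vert p.2 ∧
      H.opp p.1 < H.opp p.2 then 1 else 0) + ∑ p : (E × Bool) × (E × Bool),
      (if H.vert p.1 = H.vert p.2 ∧ H.opp p.2 < H.opp p.1 then 1 else 0) := by
    rw [← Finset.sum_add_distrib]
    refine Finset.sum_congr rfl fun p _ => ?_
    by_cases hv : H.vert p.1 = H.vert p.2
    · rcases lt_trichotomy (H.opp p.1) (H.opp p.2) with ho | ho | ho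
      · have : p.1 ≠ p.2 := fun h => ho.ne (congrArg _ h)
        simp [hv, this, ho, ho.asymm]
      · simp [H.vert_opp_inj hv ho]
      · have : p.1 ≠ p.2 := fun h => ho.ne' (congrArg _ h)
        simp [hv, this, ho, ho.asymm]
    · simp [hv]
  rw [Finset.sum_filter]
  rw [hswap, hsum] at hsplit
  have : Fintype.card E * 2 * (k - 1) = Fintype.card E * (k - 1) * 2 := by ring
  omega

end OrderedEdges

/-- The coefficients of the iterated forward difference of order `k - 1`. -/
def diffWeight {k : ℕ} (j : Fin k) : ℤ := (-1) ^ (k - 1 - (j : ℕ)) * ((k - 1).choose j : ℤ)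

theorem diffWeight_ne_zero {k : ℕ} (j : Fin k) : diffWeight j ≠ 0 :=
  mul_ne_zero (pow_ne_zero _ (by simp))
    (Nat.cast_ne_zero.2 (Nat.choose_pos (Nat.le_sub_one_of_lt j.2)).ne')

theorem sum_pow_mul_diffWeight {k m : ℕ} (h : m < k - 1) :
    ∑ j : Fin k, ((j : ℕ) : ℤ) ^ m * diffWeight j = 0 := by
  have h1 := congrFun (fwdDiff_iter_pow_eq_zero_of_lt (R := ℤ) h) 0
  obtain ⟨l, rfl⟩ : ∃ l, k = l + 1 := ⟨k - 1, by omega⟩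
  rw [fwdDiff_iter_eq_sum_shift, Finset.sum_range] at h1
  simpa [diffWeight, mul_comm] using h1

/-- If the coefficient of `∏ X_e ^ (k - 1)` in a homogeneous polynomial of the same degree
vanishes, then so does a certain weighted sum of its values on the grid `{0, …, k - 1}`. -/
theorem sum_eval_mul_diffWeight_eq_zero {E : Type*} [Fintype E] {k : ℕ} {f : MvPolynomial E ℤ}
    (hf : f.IsHomogeneous (Fintype.card E * (k - 1)))
    (h0 : f.coeff (Finsupp.equivFunOnFinite.symm fun _ => k - 1) = 0) :
    ∑ c : E → Fin k, MvPolynomial.eval (fun e => ((c e : ℕ) : ℤ)) f *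
      ∏ e, diffWeight (c e) = 0 := by
  simp only [MvPolynomial.eval_eq', Finset.sum_mul]
  rw [Finset.sum_comm]
  refine Finset.sum_eq_zero fun d hd => ?_
  simp only [mul_assoc, ← Finset.prod_mul_distrib, ← Finset.mul_sum]
  refine mul_eq_zero_of_right _ ?_
  have hdeg : d.degree = Fintype.card E * (k - 1) := by
    rw [Finsupp.degree_eq_weight_one]
    exact hf (MvPolynomial.mem_support_iff.1 hd)
  obtain ⟨e, he⟩ : ∃ e, d e < k - 1 := by
    by_contra! hge
    refine MvPolynomial.mem_support_iff.1 hd ?_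
    rw [← h0]
    congr 1
    ext e
    have h1 : ∑ _e : E, (k - 1) = ∑ e, d e := by
      rw [← Finsupp.degree_eq_sum, hdeg]; simp
    exact ((Finset.sum_eq_sum_iff_of_le fun e _ => hge e).1 h1 e (Finset.mem_univ e)).symm
  rw [← Fintype.piFinset_univ, ← Finset.prod_univ_sum (fun _ : E => (Finset.univ : Finset (Fin k)))
    (fun e j => ((j : ℕ) : ℤ) ^ d e * diffWeight j)]
  exact Finset.prod_eq_zero (Finset.mem_univ e) (sum_pow_mul_diffWeight he)

/-- If the signed count of proper `k`-edge-colorings of a `k`-regular graph does not vanish, then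
the graph can be properly edge-colored from arbitrary lists of `k` integers. -/
theorem OrderedEdges.exists_listColoring {E V : Type*} [LinearOrder V] [Fintype E] [Fintype V]
    (H : OrderedEdges E V) {n k : ℕ} (hk : 0 < k) (hV : Fintype.card V = 2 * n)
    (hcard : Fintype.card E * 2 = Fintype.card V * k)
    (hsum : ∑ c : E → Fin k with H.Proper c, H.crossSign c ≠ 0)
    (S : E → Finset ℤ) (hS : ∀ e, k ≤ (S e).card) :
    ∃ s : E → ℤ, (∀ e, s e ∈ S e) ∧
      ∀ x y : E × Bool, x ≠ y → H.vert x = H.vert y → s x.1 ≠ s y.1 := by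
  obtain ⟨c₀, hc₀⟩ : ∃ c : E → Fin k, H.Proper c := by
    by_contra! h
    exact hsum (by simp [h])
  have hhom := hc₀.isHomogeneous_linePoly hcard
  have hcoeff : H.linePoly.coeff (Finsupp.equivFunOnFinite.symm fun _ => k - 1) ≠ 0 := by
    intro h0
    have h1 := sum_eval_mul_diffWeight_eq_zero hhom h0
    have h2 : ∀ c : E → Fin k, MvPolynomial.eval (fun e => ((c e : ℕ) : ℤ)) H.linePoly *
        ∏ e, diffWeight (c e) = if H.Proper c then
          (H.signConst k * ∏ i : Fin k, diffWeight i ^ n) * H.crossSign c else 0 := by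
      intro c
      split_ifs with hc
      · rw [H.eval_linePoly_color, H.pairProd_localFactor c hc hcard,
          ← Finset.prod_fiberwise Finset.univ c fun e => diffWeight (c e)]
        have : ∀ i, ∏ e with c e = i, diffWeight (c e) = diffWeight i ^ n := fun i => by
          rw [Finset.prod_congr rfl (g := fun _ => diffWeight i)
            (fun e he => by rw [(Finset.mem_filter.1 he).2]), Finset.prod_const]
          have := hc.card_color_fiber hcard i
          congr 1
          omega
        simp only [this]
        ring
      · rw [H.eval_linePoly_eq_zero c hc, zero_mul]
    simp only [h2, ← Finset.sum_filter, ← Finset.mul_sum] at h1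
    refine mul_ne_zero (mul_ne_zero (H.signConst_ne_zero k) ?_) hsum h1
    exact Finset.prod_ne_zero_iff.2 fun i _ => pow_ne_zero _ (diffWeight_ne_zero i)
  obtain ⟨s, hs, hs'⟩ := MvPolynomial.combinatorial_nullstellensatz_exists_eval_nonzero
    H.linePoly _ hcoeff (by
      rw [hhom.totalDegree (fun h => hcoeff (by simp [h])), Finsupp.degree_eq_sum]
      simp) S (fun e => by have := hS e; simp; omega)
  exact ⟨s, hs, fun x y hxy hv => H.eval_linePoly_ne_zero hs' hxy hv⟩

section Graph

variable {m : ℕ} (G : SimpleGraph (Fin m))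

/-- The edges of a graph on a linearly ordered vertex set, with their endpoints in order. -/
def graphEdges : OrderedEdges G.edgeSet (Fin m) where
  lo e := e.1.inf
  hi e := e.1.sup
  lo_lt_hi := by
    rintro ⟨e, he⟩
    induction e with | _ a b
    exact inf_lt_sup.2 (G.ne_of_adj he)
  inj e f h1 h2 := Subtype.ext (Sym2.inf_eq_inf_and_sup_eq_sup.1 ⟨h1, h2⟩)

theorem mk_lo_hi (e : G.edgeSet) : s((graphEdges G).lo e, (graphEdges G).hi e) = e.1 :=
  Sym2.sortEquiv.left_inv e.1

theorem mem_iff_exists_vert (e : G.edgeSet) (v : Fin m) :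
    v ∈ e.1 ↔ ∃ b, (graphEdges G).vert (e, b) = v := by
  rw [← mk_lo_hi]
  simp [OrderedEdges.vert, eq_comm]

theorem crosses_iff (e f : G.edgeSet) : crosses e.1 f.1 ↔ (graphEdges G).Cross e f := by
  constructor
  · rintro ⟨a, b, c, d, he, hf, hab, hbc, hcd⟩
    simp only [OrderedEdges.Cross, graphEdges, he, hf, Sym2.inf_mk, Sym2.sup_mk]
    rw [inf_of_le_left (hab.trans hbc).le, inf_of_le_left (hbc.trans hcd).le,
      sup_of_le_right (hab.trans hbc).le, sup_of_le_right (hbc.trans hcd).le]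
    exact ⟨hab, hbc, hcd⟩
  · rintro ⟨h1, h2, h3⟩
    exact ⟨_, _, _, _, (mk_lo_hi G e).symm, (mk_lo_hi G f).symm, h1, h2, h3⟩

variable [Fintype G.edgeSet] {k : ℕ} {G}

/-- The color classes of an edge coloring. -/
noncomputable def colorClass (c : G.edgeSet → Fin k) (i : Fin k) : Finset (Sym2 (Fin m)) :=
  (Finset.univ.filter fun e => c e = i).map (Function.Embedding.subtype _)

theorem mem_colorClass {c : G.edgeSet → Fin k} {i : Fin k} {e : Sym2 (Fin m)} :
    e ∈ colorClass c i ↔ ∃ h : e ∈ G.edgeSet, c ⟨e, h⟩ = i := by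
  simp [colorClass]

theorem prod_matchingSign_colorClass (c : G.edgeSet → Fin k) :
    ∏ i, matchingSign (colorClass c i) = (graphEdges G).crossSign c := by
  have h : ∀ i, matchingSign (colorClass c i) = ∏ e with c e = i, ∏ f : G.edgeSet,
      if c e = c f ∧ (graphEdges G).Cross e f then -1 else 1 := fun i => by
    rw [matchingSign, ← Finset.prod_const, Finset.prod_filter, Finset.prod_product, colorClass,
      Finset.prod_map]
    refine Finset.prod_congr rfl fun e he => ?_
    rw [Finset.prod_map, Finset.prod_filter]
    refine Finset.prod_congr rfl fun f _ => ?_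
    rw [(Finset.mem_filter.1 he).2]
    by_cases hf : c f = i
    · simp [hf, crosses_iff]
    · simp [hf, Ne.symm hf]
  simp only [h, OrderedEdges.crossSign]
  exact Finset.prod_fiberwise _ _ _

theorem isOrderedOneFactorization_colorClass {c : G.edgeSet → Fin k}
    (hc : (graphEdges G).Proper c) (hcard : Fintype.card G.edgeSet * 2 = Fintype.card (Fin m) * k) :
    IsOrderedOneFactorization G (colorClass c) := by
  refine ⟨fun i => ⟨fun e he => (mem_colorClass.1 he).1, fun v => ?_⟩, fun e => ⟨fun he => ?_, ?_⟩⟩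
  · obtain ⟨x, hx⟩ := (hc.bijective hcard).2 (v, i)
    obtain ⟨hx1, hx2⟩ := Prod.mk.injEq _ _ _ _ ▸ hx
    refine ⟨x.1, ⟨mem_colorClass.2 ⟨x.1.2, hx2⟩, (mem_iff_exists_vert G _ _).2 ⟨x.2, hx1⟩⟩, ?_⟩
    rintro e ⟨he, hv⟩
    obtain ⟨he, hi⟩ := mem_colorClass.1 he
    obtain ⟨b, hb⟩ := (mem_iff_exists_vert G ⟨e, he⟩ v).1 hv
    exact congrArg (fun y => y.1.1) (hc (⟨e, he⟩, b) x (hb.trans hx1.symm) (hi.trans hx2.symm))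
  · exact ⟨c ⟨e, he⟩, mem_colorClass.2 ⟨he, rfl⟩, fun i hi => (mem_colorClass.1 hi).2.symm⟩
  · rintro ⟨i, hi, -⟩
    exact (mem_colorClass.1 hi).1

theorem exists_colorClass_eq {𝓕 : Fin k → Finset (Sym2 (Fin m))}
    (h : IsOrderedOneFactorization G 𝓕) :
    ∃ c : G.edgeSet → Fin k, (graphEdges G).Proper c ∧ colorClass c = 𝓕 := by
  choose c hc huniq using fun e : G.edgeSet => (h.2 e.1).1 e.2
  refine ⟨c, fun x y hv hcol => ?_, ?_⟩
  · have hxy : x.1.1 = y.1.1 := ((h.1 (c x.1)).2 ((graphEdges G).vert x)).unique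
      ⟨hc x.1, (mem_iff_exists_vert G _ _).2 ⟨x.2, rfl⟩⟩
      ⟨hcol ▸ hc y.1, (mem_iff_exists_vert G _ _).2 ⟨y.2, hv.symm⟩⟩
    obtain ⟨e, b⟩ := x
    obtain ⟨f, b'⟩ := y
    obtain rfl : e = f := Subtype.ext hxy
    have hlt := (graphEdges G).lo_lt_hi e
    cases b <;> cases b' <;> simp_all [OrderedEdges.vert]
  · ext i e
    rw [mem_colorClass]
    refine ⟨?_, fun he => ⟨(h.1 i).1 e he, (huniq ⟨e, _⟩ i he).symm⟩⟩
    rintro ⟨he, rfl⟩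
    exact hc ⟨e, he⟩

theorem factorizationSignSum_eq
    (hcard : Fintype.card G.edgeSet * 2 = Fintype.card (Fin m) * k) :
    ∑ c : G.edgeSet → Fin k with (graphEdges G).Proper c, (graphEdges G).crossSign c =
      factorizationSignSum k G := by
  refine Finset.sum_bij (fun c _ => colorClass c) ?_ ?_ ?_ ?_
  · intro c hc
    simpa using isOrderedOneFactorization_colorClass (by simpa using hc) hcard
  · intro c _ c' _ h
    funext e
    have : e.1 ∈ colorClass c' (c e) := h ▸ mem_colorClass.2 ⟨e.2, rfl⟩
    exact (mem_colorClass.1 this).2.symm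
  · intro 𝓕 h𝓕
    obtain ⟨c, hc, rfl⟩ := exists_colorClass_eq (by simpa using h𝓕 :
      IsOrderedOneFactorization G 𝓕)
    exact ⟨c, by simpa using hc, rfl⟩
  · intro c _
    exact (prod_matchingSign_colorClass c).symm

end Graph

end ListEdgeColoring

theorem schauz_sign_sum_nonzero_implies_list_edge_colorable
    (n k : ℕ) (hn : 0 < n) (hk : 0 < k)
    (G : SimpleGraph (Fin (2 * n))) [DecidableRel G.Adj]
    (hreg : G.IsRegularOfDegree k)
    (hsum : factorizationSignSum k G ≠ 0) :
    ListEdgeColorable G k := by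
  intro α L hL
  have hcard : Fintype.card G.edgeSet * 2 = Fintype.card (Fin (2 * n)) * k := by
    rw [← G.edgeFinset_card, mul_comm, ← G.sum_degrees_eq_twice_card_edges]
    simp [hreg.degree_eq]
  obtain ⟨e₀⟩ : Nonempty G.edgeSet := by
    rw [← Fintype.card_pos_iff]
    have : 0 < Fintype.card (Fin (2 * n)) * k := by simp [hn, hk]
    omega
  obtain ⟨ι, hι⟩ := Set.countable_iff_exists_injOn.1
    (Set.countable_iUnion fun e => (L e).countable_toSet)
  have hmem : ∀ {e a}, a ∈ L e → a ∈ ⋃ e, (L e : Set α) := fun {e a} h =>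
    Set.mem_iUnion.2 ⟨e, h⟩
  have hinj : ∀ {e f a b}, a ∈ L e → b ∈ L f → (ι a : ℤ) = ι b → a = b := fun ha hb h =>
    hι (hmem ha) (hmem hb) (Nat.cast_injective h)
  obtain ⟨s, hs, hs'⟩ := (ListEdgeColoring.graphEdges G).exists_listColoring hk
    (Fintype.card_fin _) hcard
    (by rw [← ListEdgeColoring.factorizationSignSum_eq hcard] at hsum; convert hsum)
    (fun e => (L e.1).image fun a => (ι a : ℤ)) fun e => by
      rw [Finset.card_image_of_injOn fun a ha b hb h => hinj ha hb h]
      exact hL e.1 e.2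
  choose col hcol hcols using fun e => Finset.mem_image.1 (hs e)
  refine ⟨fun e => if h : e ∈ G.edgeSet then col ⟨e, h⟩ else col e₀, fun e he => ?_, ?_⟩
  · simpa [he] using hcol ⟨e, he⟩
  · rintro e₁ h₁ e₂ h₂ hne ⟨v, hv₁, hv₂⟩ heq
    obtain ⟨b₁, hb₁⟩ := (ListEdgeColoring.mem_iff_exists_vert G ⟨e₁, h₁⟩ v).1 hv₁
    obtain ⟨b₂, hb₂⟩ := (ListEdgeColoring.mem_iff_exists_vert G ⟨e₂, h₂⟩ v).1 hv₂
    refine hs' (⟨e₁, h₁⟩, b₁) (⟨e₂, h₂⟩, b₂) (fun h => hne (congrArg (fun x => x.1.1) h))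
      (hb₁.trans hb₂.symm) ?_
    rw [← hcols, ← hcols]
    simp only [h₁, h₂, dif_pos] at heq
    rw [heq]
end

section
/- Let G₄′ be the 6-regular simple graph on vertex set {0,1,...,7} with edges given by the adjacency lists: 0 ~ 1,2,3,4,5,6; 1 ~ 0,2,3,4,5,7; 2 ~ 0,1,3,5,6,7; 3 ~ 0,1,2,4,6,7; 4 ~ 0,1,3,5,6,7; 5 ~ 0,1,2,4,6,7; 6 ~ 0,2,3,4,5,7; 7 ~ 1,2,3,4,5,6. Then the sum of sign(𝓕) over all ordered 1-factorizations 𝓕 of G₄′ is nonzero. -/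
open scoped Classical

/-- The 6-regular graph `G4'` on `{0, …, 7}`. -/
def G4' : SimpleGraph (Fin 8) :=
  SimpleGraph.fromEdgeSet
    {s(0, 1), s(0, 2), s(0, 3), s(0, 4), s(0, 5), s(0, 6), s(1, 2), s(1, 3), s(1, 4), s(1, 5), s(1, 7), s(2, 3), s(2, 5), s(2, 6), s(2, 7), s(3, 4), s(3, 6), s(3, 7), s(4, 5), s(4, 6), s(4, 7), s(5, 6), s(5, 7), s(6, 7)}

/-- The sum of `∏ i, w (𝓕 i)` over all ways `𝓕` of distributing the elements of `E` over `k`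
labelled blocks. -/
def partitionSum {α : Type*} [Fintype α] [DecidableEq α] (w : Finset α → ℤ) (k : ℕ)
    (E : Finset α) : ℤ :=
  ∑ 𝓕 : Fin k → Finset α with
    ∀ x, (∑ i, if x ∈ 𝓕 i then 1 else 0) = if x ∈ E then 1 else 0, ∏ i, w (𝓕 i)

lemma partitionSum_zero {α : Type*} [Fintype α] [DecidableEq α] (w : Finset α → ℤ) :
    partitionSum w 0 ∅ = 1 := by
  simp [partitionSum]

/-- Blocks are interchangeable, so a given element may be assumed to lie in the first one. -/
lemma partitionSum_succ {α : Type*} [Fintype α] [DecidableEq α] (w : Finset α → ℤ) (k : ℕ)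
    {E : Finset α} {e : α} (he : e ∈ E) :
    partitionSum w (k + 1) E =
      (k + 1) * ∑ M ∈ E.powerset with e ∈ M, w M * partitionSum w k (E \ M) := by
  have hsplit : partitionSum w (k + 1) E = ∑ i : Fin (k + 1), ∑ 𝓕 : Fin (k + 1) → Finset α with
      (∀ x, (∑ i, if x ∈ 𝓕 i then 1 else 0) = if x ∈ E then 1 else 0) ∧ e ∈ 𝓕 i,
        ∏ i, w (𝓕 i) := by
    simp_rw [← Finset.filter_filter, Finset.sum_filter (fun 𝓕 : Fin (k + 1) → Finset α => e ∈ 𝓕 _)]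
    rw [Finset.sum_comm]
    refine Finset.sum_congr rfl fun 𝓕 h𝓕 => ?_
    have h := (Finset.mem_filter.1 h𝓕).2 e
    simp only [he, if_true, Finset.sum_boole, Nat.cast_id] at h
    rw [← Finset.sum_filter, Finset.sum_const, h, one_smul]
  have hswap (i : Fin (k + 1)) : ∑ 𝓕 : Fin (k + 1) → Finset α with
      (∀ x, (∑ i, if x ∈ 𝓕 i then 1 else 0) = if x ∈ E then 1 else 0) ∧ e ∈ 𝓕 i,
        ∏ i, w (𝓕 i) = ∑ 𝓕 : Fin (k + 1) → Finset α with
      (∀ x, (∑ i, if x ∈ 𝓕 i then 1 else 0) = if x ∈ E then 1 else 0) ∧ e ∈ 𝓕 0,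
        ∏ i, w (𝓕 i) := by
    refine Finset.sum_equiv (Equiv.arrowCongr (Equiv.swap 0 i) (Equiv.refl _))
      (fun 𝓕 => ?_) (fun 𝓕 _ => ?_)
    · have h (x : α) : (∑ j, if x ∈ Equiv.arrowCongr (Equiv.swap 0 i) (Equiv.refl _) 𝓕 j
          then 1 else 0) = ∑ j, if x ∈ 𝓕 j then 1 else 0 :=
        Equiv.sum_comp (Equiv.swap 0 i) fun j => if x ∈ 𝓕 j then 1 else 0
      simp only [Finset.mem_filter, Finset.mem_univ, true_and, h]
      simp
    · simpa [Equiv.arrowCongr] using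
        (Equiv.prod_comp (Equiv.swap 0 i) fun j => w (𝓕 j)).symm
  have hcons : ∑ 𝓕 : Fin (k + 1) → Finset α with
      (∀ x, (∑ i, if x ∈ 𝓕 i then 1 else 0) = if x ∈ E then 1 else 0) ∧ e ∈ 𝓕 0,
        ∏ i, w (𝓕 i) = ∑ M ∈ E.powerset with e ∈ M, w M * partitionSum w k (E \ M) := by
    have key (M : Finset α) (𝓕 : Fin k → Finset α) :
        (∀ x, (if x ∈ M then 1 else 0) + (∑ i, if x ∈ 𝓕 i then 1 else 0) =
          if x ∈ E then 1 else 0) ↔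
        M ⊆ E ∧ ∀ x, (∑ i, if x ∈ 𝓕 i then 1 else 0) = if x ∈ E \ M then 1 else 0 := by
      rw [Finset.subset_iff, ← forall_and]
      refine forall_congr' fun x => ?_
      by_cases hM : x ∈ M <;> by_cases hE : x ∈ E <;> simp [hM, hE]
    simp_rw [partitionSum, Finset.mul_sum]
    rw [Finset.sum_sigma']
    refine Finset.sum_bij' (fun 𝓕 _ => ⟨𝓕 0, Fin.tail 𝓕⟩) (fun p _ => Fin.cons p.1 p.2)
      ?_ ?_ ?_ ?_ ?_
    · intro 𝓕 h
      simp only [Finset.mem_filter, Finset.mem_univ, true_and, Fin.sum_univ_succ, key] at h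
      simp only [Finset.mem_sigma, Finset.mem_filter, Finset.mem_powerset, Finset.mem_univ,
        true_and]
      exact ⟨⟨h.1.1, h.2⟩, h.1.2⟩
    · intro p h
      simp only [Finset.mem_filter, Finset.mem_univ, true_and, Fin.sum_univ_succ, key]
      simpa [and_right_comm] using h
    · intro 𝓕 _
      simp
    · intro p _
      simp
    · intro 𝓕 _
      simp [Fin.prod_univ_succ, Fin.tail]
  rw [hsplit, Finset.sum_congr rfl fun i _ => hswap i, hcons]
  simp

/-- The edges joining each vertex `v` to its partner `p v`. -/
def pairing {m : ℕ} (p : Fin m → Fin m) : Finset (Sym2 (Fin m)) :=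
  Finset.univ.image fun v => s(v, p v)

lemma mk_mem_pairing {m : ℕ} {p : Fin m → Fin m} (hp : Function.Involutive p) {a b : Fin m} :
    s(a, b) ∈ pairing p ↔ p a = b := by
  simp only [pairing, Finset.mem_image, Finset.mem_univ, true_and, Sym2.eq_iff]
  constructor
  · rintro ⟨v, ⟨rfl, rfl⟩ | ⟨rfl, rfl⟩⟩
    · rfl
    · exact hp v
  · rintro rfl
    exact ⟨a, Or.inl ⟨rfl, rfl⟩⟩

lemma isPerfectMatchingOf_iff {m : ℕ} {G : SimpleGraph (Fin m)} {F : Finset (Sym2 (Fin m))} :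
    IsPerfectMatchingOf G F ↔
      ∃ p : Fin m → Fin m, Function.Involutive p ∧ (∀ v, G.Adj v (p v)) ∧ F = pairing p := by
  constructor
  · rintro ⟨hG, hF⟩
    have hex (v : Fin m) : ∃ u, s(v, u) ∈ F := by
      obtain ⟨e, ⟨he, u, rfl⟩, -⟩ := hF v
      exact ⟨u, he⟩
    choose p hpF using hex
    have hp : Function.Involutive p := fun v => by
      have h := (hF (p v)).unique ⟨hpF (p v), Sym2.mem_mk_left _ _⟩ ⟨hpF v, Sym2.mem_mk_right _ _⟩
      rw [Sym2.eq_swap] at h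
      exact Sym2.congr_left.1 h
    refine ⟨p, hp, fun v => hG _ (hpF v), Finset.ext fun e => ?_⟩
    induction e with
    | h a b =>
      rw [mk_mem_pairing hp]
      constructor
      · intro h
        exact Sym2.congr_right.1
          ((hF a).unique ⟨hpF a, Sym2.mem_mk_left _ _⟩ ⟨h, Sym2.mem_mk_left _ _⟩)
      · rintro rfl
        exact hpF a
  · rintro ⟨p, hp, hG, rfl⟩
    refine ⟨fun e he => ?_, fun v => ⟨s(v, p v), ⟨(mk_mem_pairing hp).2 rfl,
      Sym2.mem_mk_left _ _⟩, ?_⟩⟩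
    · obtain ⟨v, -, rfl⟩ := Finset.mem_image.1 he
      exact hG v
    · rintro _ ⟨he, u, rfl⟩
      rw [(mk_mem_pairing hp).1 he]

/-- The sign of the matching that joins each vertex `v` to `p v`. -/
def crossingSign {m : ℕ} (p : Fin m → Fin m) : ℤ :=
  ∏ a : Fin m, ∏ b : Fin m, if a < b ∧ b < p a ∧ p a < p b then -1 else 1

lemma matchingSign_pairing {m : ℕ} {p : Fin m → Fin m} (hp : Function.Involutive p) :
    matchingSign (pairing p) = crossingSign p := by
  have hcard : (Finset.filter (fun q : Sym2 (Fin m) × Sym2 (Fin m) => crosses q.1 q.2)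
      (pairing p ×ˢ pairing p)).card =
      (Finset.univ.filter fun q : Fin m × Fin m =>
        q.1 < q.2 ∧ q.2 < p q.1 ∧ p q.1 < p q.2).card := by
    symm
    refine Finset.card_bij (fun q _ => (s(q.1, p q.1), s(q.2, p q.2))) ?_ ?_ ?_
    · rintro ⟨a, b⟩ h
      simp only [Finset.mem_filter, Finset.mem_univ, true_and] at h
      simp only [Finset.mem_filter, Finset.mem_product, mk_mem_pairing hp, true_and]
      exact ⟨a, b, p a, p b, rfl, rfl, h⟩
    · rintro ⟨a, b⟩ h ⟨a', b'⟩ h' heq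
      simp only [Finset.mem_filter, Finset.mem_univ, true_and] at h h'
      simp only [Prod.mk.injEq, Sym2.eq_iff] at heq ⊢
      grind
    · rintro ⟨e, f⟩ h
      simp only [Finset.mem_filter, Finset.mem_product] at h
      obtain ⟨⟨he, hf⟩, a, b, c, d, rfl, rfl, hab, hbc, hcd⟩ := h
      rw [mk_mem_pairing hp] at he hf
      subst he hf
      exact ⟨(a, b), by simp [hab, hbc, hcd], rfl⟩
  rw [matchingSign, hcard, crossingSign, ← Fintype.prod_prod_type', Finset.prod_ite]
  simp

/-- The partner of `v` in the matching encoded by the decimal digits of `n`: the digits of an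
eight-digit number `n` are, from left to right, the partners of `0, …, 7`. -/
def partner (n : ℕ) (v : Fin 8) : Fin 8 :=
  Fin.ofNat 8 (n / 10 ^ (7 - v : ℕ) % 10)

/-- The perfect matchings of the graph, in the encoding of `partner`. -/
def matchingCodes : List ℕ :=
  [10325476, 10326745, 10327654, 10543276, 10567234, 10576243,
   10643725, 10675423, 10743652, 10765432, 23015476, 23016745,
   23017654, 24061735, 24071653, 25043176, 25067134, 25076143,
   27043651, 27065431, 32105476, 32106745, 32107654, 34501276,
   34601725, 34701652, 35607124, 35706142, 37506241, 37605421,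
   42160735, 42170653, 43510276, 43610725, 43710652, 45320176,
   45670123, 45760132, 47320651, 47560231, 52143076, 52167034,
   52176043, 53617024, 53716042, 54321076, 54671023, 54761032,
   57326041, 57643021, 62143705, 62175403, 63517204, 63715402,
   64321705, 64571203, 65327104, 65743102, 67325401, 67543201]

/-- The graph is the complement of a perfect matching. -/
lemma G4'_adj_iff (a b : Fin 8) : G4'.Adj a b ↔ a ≠ b ∧ partner 76452310 a ≠ b := by
  simp only [G4', SimpleGraph.fromEdgeSet_adj, Set.mem_insert_iff, Set.mem_singleton_iff]
  revert a b
  decide +kernel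

lemma nodup_matchingCodes : matchingCodes.Nodup := by
  decide +kernel

lemma partner_involutive {n : ℕ} (hn : n ∈ matchingCodes) : Function.Involutive (partner n) := by
  have h : ∀ n ∈ matchingCodes, ∀ v, partner n (partner n v) = v := by decide +kernel
  exact h n hn

lemma adj_partner {n : ℕ} (hn : n ∈ matchingCodes) (v : Fin 8) : G4'.Adj v (partner n v) := by
  have h : ∀ n ∈ matchingCodes, ∀ v, v ≠ partner n v ∧ partner 76452310 v ≠ partner n v := by
    decide +kernel
  exact (G4'_adj_iff _ _).2 (h n hn v)

lemma partner_injOn : ∀ n ∈ matchingCodes, ∀ n' ∈ matchingCodes,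
    (∀ v, partner n v = partner n' v) → n = n' := by
  decide +kernel

set_option synthInstance.maxSize 2000 in
set_option synthInstance.maxHeartbeats 400000 in
lemma exists_matchingCode {p : Fin 8 → Fin 8} (hp : Function.Involutive p)
    (hG : ∀ v, G4'.Adj v (p v)) : ∃ n ∈ matchingCodes, partner n = p := by
  have h : ∀ p₀, (0 ≠ p₀ ∧ partner 76452310 0 ≠ p₀) →
      ∀ p₁, (1 ≠ p₁ ∧ partner 76452310 1 ≠ p₁) → (p₁ = 0 ↔ p₀ = 1) →
      ∀ p₂, (2 ≠ p₂ ∧ partner 76452310 2 ≠ p₂) → (p₂ = 0 ↔ p₀ = 2) → (p₂ = 1 ↔ p₁ = 2) →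
      ∀ p₃, (3 ≠ p₃ ∧ partner 76452310 3 ≠ p₃) → (p₃ = 0 ↔ p₀ = 3) → (p₃ = 1 ↔ p₁ = 3) →
        (p₃ = 2 ↔ p₂ = 3) →
      ∀ p₄, (4 ≠ p₄ ∧ partner 76452310 4 ≠ p₄) → (p₄ = 0 ↔ p₀ = 4) → (p₄ = 1 ↔ p₁ = 4) →
        (p₄ = 2 ↔ p₂ = 4) → (p₄ = 3 ↔ p₃ = 4) →
      ∀ p₅, (5 ≠ p₅ ∧ partner 76452310 5 ≠ p₅) → (p₅ = 0 ↔ p₀ = 5) → (p₅ = 1 ↔ p₁ = 5) →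
        (p₅ = 2 ↔ p₂ = 5) → (p₅ = 3 ↔ p₃ = 5) → (p₅ = 4 ↔ p₄ = 5) →
      ∀ p₆, (6 ≠ p₆ ∧ partner 76452310 6 ≠ p₆) → (p₆ = 0 ↔ p₀ = 6) → (p₆ = 1 ↔ p₁ = 6) →
        (p₆ = 2 ↔ p₂ = 6) → (p₆ = 3 ↔ p₃ = 6) → (p₆ = 4 ↔ p₄ = 6) → (p₆ = 5 ↔ p₅ = 6) →
      ∀ p₇, (7 ≠ p₇ ∧ partner 76452310 7 ≠ p₇) → (p₇ = 0 ↔ p₀ = 7) → (p₇ = 1 ↔ p₁ = 7) →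
        (p₇ = 2 ↔ p₂ = 7) → (p₇ = 3 ↔ p₃ = 7) → (p₇ = 4 ↔ p₄ = 7) → (p₇ = 5 ↔ p₅ = 7) →
        (p₇ = 6 ↔ p₆ = 7) →
      ∃ n ∈ matchingCodes, partner n 0 = p₀ ∧ partner n 1 = p₁ ∧ partner n 2 = p₂ ∧
        partner n 3 = p₃ ∧ partner n 4 = p₄ ∧ partner n 5 = p₅ ∧ partner n 6 = p₆ ∧
        partner n 7 = p₇ := by
    decide +kernel
  have hG' (v : Fin 8) := (G4'_adj_iff _ _).1 (hG v)
  have hs (a b : Fin 8) : p a = b ↔ p b = a :=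
    ⟨fun h => h ▸ hp a, fun h => h ▸ hp b⟩
  obtain ⟨n, hn, h₀, h₁, h₂, h₃, h₄, h₅, h₆, h₇⟩ :=
    h _ (hG' 0) _ (hG' 1) (hs _ _) _ (hG' 2) (hs _ _) (hs _ _) _ (hG' 3) (hs _ _) (hs _ _) (hs _ _)
      _ (hG' 4) (hs _ _) (hs _ _) (hs _ _) (hs _ _)
      _ (hG' 5) (hs _ _) (hs _ _) (hs _ _) (hs _ _) (hs _ _)
      _ (hG' 6) (hs _ _) (hs _ _) (hs _ _) (hs _ _) (hs _ _) (hs _ _)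
      _ (hG' 7) (hs _ _) (hs _ _) (hs _ _) (hs _ _) (hs _ _) (hs _ _) (hs _ _)
  refine ⟨n, hn, funext fun v => ?_⟩
  fin_cases v <;> assumption

/-- The sum of the signs of all families of pairwise disjoint matchings, taken from the list `A`
of codes, in which vertex `0` has the prescribed partners in turn. -/
def searchSum : List (Fin 8) → List ℕ → ℤ
  | [], _ => 1
  | j :: js, A => ((A.filter fun n => partner n 0 = j).map fun n =>
      crossingSign (partner n) *
        searchSum js (A.filter fun n' => ∀ v, partner n v ≠ partner n' v)).sum

lemma card_pairing_partner {n : ℕ} (hn : n ∈ matchingCodes) : (pairing (partner n)).card = 4 := by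
  have h : ∀ n ∈ matchingCodes, (pairing (partner n)).card = 4 := by decide +kernel
  exact h n hn

lemma pairing_partner_subset_sdiff {n n' : ℕ} (hn : n ∈ matchingCodes) (hn' : n' ∈ matchingCodes)
    {E : Finset (Sym2 (Fin 8))} :
    pairing (partner n') ⊆ E \ pairing (partner n) ↔
      pairing (partner n') ⊆ E ∧ ∀ v, partner n v ≠ partner n' v := by
  rw [Finset.subset_sdiff]
  refine and_congr_right fun _ => ?_
  rw [Finset.disjoint_left]
  constructor
  · intro h v hv
    exact h ((mk_mem_pairing (partner_involutive hn')).2 rfl)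
      ((mk_mem_pairing (partner_involutive hn)).2 hv)
  · intro h e he hmem
    obtain ⟨v, -, rfl⟩ := Finset.mem_image.1 he
    exact h v ((mk_mem_pairing (partner_involutive hn)).1 hmem)

/-- The sign of `F` if `F` is a perfect matching of the graph, and `0` otherwise. -/
noncomputable def matchingWeight (F : Finset (Sym2 (Fin 8))) : ℤ :=
  if IsPerfectMatchingOf G4' F then matchingSign F else 0

lemma matchingWeight_pairing_partner {n : ℕ} (hn : n ∈ matchingCodes) :
    matchingWeight (pairing (partner n)) = crossingSign (partner n) := by
  rw [matchingWeight, if_pos, matchingSign_pairing (partner_involutive hn)]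
  exact isPerfectMatchingOf_iff.2 ⟨_, partner_involutive hn, adj_partner hn, rfl⟩

lemma partitionSum_eq_searchSum (js : List (Fin 8)) : ∀ (A : List ℕ) (E : Finset (Sym2 (Fin 8))),
    js.Nodup → A.Nodup → (∀ n, n ∈ A ↔ n ∈ matchingCodes ∧ pairing (partner n) ⊆ E) →
    (∀ j ∈ js, s(0, j) ∈ E) → E.card = 4 * js.length →
    partitionSum matchingWeight js.length E = js.length.factorial * searchSum js A := by
  induction js with
  | nil =>
    intro A E _ _ _ _ hE
    obtain rfl : E = ∅ := by simpa using hE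
    simp [partitionSum_zero, searchSum]
  | cons j js ih =>
    intro A E hjs hA hAE hjE hE
    rw [List.nodup_cons] at hjs
    have hstep : ∑ n ∈ (A.filter fun n => partner n 0 = j).toFinset, js.length.factorial *
        (crossingSign (partner n) *
          searchSum js (A.filter fun n' => ∀ v, partner n v ≠ partner n' v)) =
        ∑ M ∈ E.powerset with s(0, j) ∈ M,
          matchingWeight M * partitionSum matchingWeight js.length (E \ M) := by
      refine Finset.sum_of_injOn (fun n => pairing (partner n)) ?_ ?_ ?_ ?_
      · intro n hn n' hn' h
        simp only [List.coe_toFinset, List.mem_filter, Set.mem_ofPred_eq, hAE] at hn hn'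
        refine partner_injOn n hn.1.1 n' hn'.1.1 fun v => ?_
        have hv : s(v, partner n' v) ∈ pairing (partner n) :=
          (Finset.ext_iff.1 h _).2 ((mk_mem_pairing (partner_involutive hn'.1.1)).2 rfl)
        exact (mk_mem_pairing (partner_involutive hn.1.1)).1 hv
      · intro n hn
        simp only [List.coe_toFinset, List.mem_filter, Set.mem_ofPred_eq, hAE,
          decide_eq_true_eq] at hn
        simp [hn.1.2, mk_mem_pairing (partner_involutive hn.1.1), hn.2]
      · intro M hM hM'
        rw [matchingWeight, if_neg, zero_mul]
        intro hPM
        obtain ⟨p, hp, hG, rfl⟩ := isPerfectMatchingOf_iff.1 hPM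
        obtain ⟨n, hn, rfl⟩ := exists_matchingCode hp hG
        simp only [Finset.mem_filter, Finset.mem_powerset, mk_mem_pairing hp] at hM
        refine hM' ⟨n, ?_, rfl⟩
        simp [hAE, hn, hM.1, hM.2]
      · intro n hn
        simp only [List.mem_toFinset, List.mem_filter, hAE, decide_eq_true_eq] at hn
        obtain ⟨⟨hn, hnE⟩, rfl⟩ := hn
        rw [matchingWeight_pairing_partner hn,
          ih (A.filter fun n' => ∀ v, partner n v ≠ partner n' v) (E \ pairing (partner n)) hjs.2 (hA.filter _)]
        · ring
        · intro n'
          by_cases hn' : n' ∈ matchingCodes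
          · simp [hAE, hn', pairing_partner_subset_sdiff hn hn']
          · simp [hAE, hn']
        · intro i hi
          rw [Finset.mem_sdiff, mk_mem_pairing (partner_involutive hn)]
          exact ⟨hjE i (List.mem_cons_of_mem _ hi), fun h => hjs.1 (h ▸ hi)⟩
        · rw [Finset.card_sdiff_of_subset hnE, hE, card_pairing_partner hn, List.length_cons]
          lia
    rw [List.length_cons, partitionSum_succ _ _ (hjE j List.mem_cons_self), ← hstep,
      ← Finset.mul_sum, List.sum_toFinset _ (hA.filter _), searchSum, Nat.factorial_succ]
    push_cast
    ring

/-- The edge set of the graph, as a finite set. -/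
def G4'Edges : Finset (Sym2 (Fin 8)) :=
  (Finset.univ.filter fun q : Fin 8 × Fin 8 => q.1 ≠ q.2 ∧ partner 76452310 q.1 ≠ q.2).image
    fun q => s(q.1, q.2)

lemma mem_G4'Edges {e : Sym2 (Fin 8)} : e ∈ G4'Edges ↔ e ∈ G4'.edgeSet := by
  simp only [G4'Edges, Finset.mem_image, Finset.mem_filter, Finset.mem_univ, true_and,
    ← G4'_adj_iff, Prod.exists]
  constructor
  · rintro ⟨a, b, h, rfl⟩
    exact h
  · induction e with
    | h a b => exact fun h => ⟨a, b, h, rfl⟩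

lemma factorizationSignSum_G4' (k : ℕ) :
    factorizationSignSum k G4' = partitionSum matchingWeight k G4'Edges := by
  have hpart (𝓕 : Fin k → Finset (Sym2 (Fin 8))) (h : ∀ i, IsPerfectMatchingOf G4' (𝓕 i)) :
      (∀ e, e ∈ G4'.edgeSet ↔ ∃! i, e ∈ 𝓕 i) ↔
        ∀ e, (∑ i, if e ∈ 𝓕 i then 1 else 0) = if e ∈ G4'Edges then 1 else 0 := by
    refine forall_congr' fun e => ?_
    rw [Fintype.existsUnique_iff_card_one, Finset.sum_boole, Nat.cast_id]
    by_cases he : e ∈ G4'.edgeSet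
    · simp [he, mem_G4'Edges]
    · have hi (i : Fin k) : e ∉ 𝓕 i := fun hi => he ((h i).1 e hi)
      simp [he, mem_G4'Edges, hi]
  rw [factorizationSignSum, partitionSum, Finset.sum_filter, Finset.sum_filter]
  refine Finset.sum_congr rfl fun 𝓕 _ => ?_
  by_cases h : ∀ i, IsPerfectMatchingOf G4' (𝓕 i)
  · simp [IsOrderedOneFactorization, hpart 𝓕 h, matchingWeight, h]
  · have h0 : ∏ i, matchingWeight (𝓕 i) = 0 := by
      obtain ⟨i, hi⟩ := not_forall.1 h
      exact Finset.prod_eq_zero (Finset.mem_univ i) (if_neg hi)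
    rw [h0, if_neg fun h' => h h'.1, ite_self]

theorem G4'_sign_sum_ne_zero : factorizationSignSum 6 G4' ≠ 0 := by
  have hsearch : searchSum [1, 2, 3, 4, 5, 6] matchingCodes = -288 := by decide +kernel
  have h := partitionSum_eq_searchSum [1, 2, 3, 4, 5, 6] matchingCodes G4'Edges (by decide)
    nodup_matchingCodes
    (fun n => ⟨fun hn => ⟨hn, fun e he => ?_⟩, And.left⟩) (by decide +kernel) (by decide +kernel)
  · rw [hsearch] at h
    rw [factorizationSignSum_G4']
    exact h.trans_ne (by decide)
  · obtain ⟨v, -, rfl⟩ := Finset.mem_image.1 he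
    exact mem_G4'Edges.2 (adj_partner hn v)
end

section
/- Let G₁₅′ be the 6-regular simple graph on vertex set {0,1,...,11} with edges given by the adjacency lists: 0 ~ 1,2,3,4,5,11; 1 ~ 0,2,4,6,9,11; 2 ~ 0,1,3,6,7,11; 3 ~ 0,2,4,7,8,11; 4 ~ 0,1,3,8,9,11; 5 ~ 0,6,7,8,9,10; 6 ~ 1,2,5,7,9,10; 7 ~ 2,3,5,6,8,10; 8 ~ 3,4,5,7,9,10; 9 ~ 1,4,5,6,8,10; 10 ~ 5,6,7,8,9,11; 11 ~ 0,1,2,3,4,10. Then the sum of sign(𝓕) over all ordered 1-factorizations 𝓕 of G₁₅′ is nonzero. -/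
open scoped Classical

/-- The 6-regular graph `G15'` on `{0, …, 11}`. -/
def G15' : SimpleGraph (Fin 12) :=
  SimpleGraph.fromEdgeSet
    {s(0, 1), s(0, 2), s(0, 3), s(0, 4), s(0, 5), s(0, 11), s(1, 2), s(1, 4), s(1, 6), s(1, 9), s(1, 11), s(2, 3), s(2, 6), s(2, 7), s(2, 11), s(3, 4), s(3, 7), s(3, 8), s(3, 11), s(4, 8), s(4, 9), s(4, 11), s(5, 6), s(5, 7), s(5, 8), s(5, 9), s(5, 10), s(6, 7), s(6, 9), s(6, 10), s(7, 8), s(7, 10), s(8, 9), s(8, 10), s(9, 10), s(10, 11)}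


/-! ### Sums over families of pairwise disjoint sets -/

section PackingSum

variable {ε : Type*} [Fintype ε] [DecidableEq ε]

/-- The sum of `∏ i, w (𝓕 i)` over all sequences `𝓕` of `k` pairwise disjoint members of `P`. -/
noncomputable def packingSum (w : Finset ε → ℤ) (k : ℕ) (P : Finset (Finset ε)) : ℤ :=
  ∑ 𝓕 : Fin k → Finset ε with (∀ i, 𝓕 i ∈ P) ∧ Pairwise fun i j => Disjoint (𝓕 i) (𝓕 j),
    ∏ i, w (𝓕 i)

/-- The sum of the weights of the disjoint families in `P` whose members contain the elements
of a list, in the order of the list. -/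
noncomputable def transversalSum (w : Finset ε → ℤ) : List ε → Finset (Finset ε) → ℤ
  | [], _ => 1
  | e :: es, P => ∑ F ∈ P with e ∈ F, w F * transversalSum w es {F' ∈ P | Disjoint F F'}

omit [Fintype ε] in
lemma exists_mem_of_pairwise_disjoint {k : ℕ} {es : List ε} (hes : es.Nodup)
    (hk : es.length = k) {P : Finset (Finset ε)} (hP : ∀ F ∈ P, ∃! e, e ∈ es ∧ e ∈ F)
    {𝓕 : Fin k → Finset ε} (h𝓕 : ∀ i, 𝓕 i ∈ P)
    (hd : Pairwise fun i j => Disjoint (𝓕 i) (𝓕 j)) {e : ε} (he : e ∈ es) :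
    ∃ i, e ∈ 𝓕 i := by
  choose c hc _ using fun i => hP _ (h𝓕 i)
  have hinj : Function.Injective c := by
    intro i j hij
    by_contra hne
    exact Finset.disjoint_left.mp (hd hne) (hc i).2 (hij ▸ (hc j).2)
  have himage : Finset.univ.image c = es.toFinset := by
    apply Finset.eq_of_subset_of_card_le
    · intro x hx
      obtain ⟨i, -, rfl⟩ := Finset.mem_image.mp hx
      exact List.mem_toFinset.mpr (hc i).1
    · rw [Finset.card_image_of_injective _ hinj, List.toFinset_card_of_nodup hes, hk]
      simp
  have : e ∈ Finset.univ.image c := himage ▸ List.mem_toFinset.mpr he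
  obtain ⟨i, -, rfl⟩ := Finset.mem_image.mp this
  exact ⟨i, (hc i).2⟩

lemma packingSum_succ (w : Finset ε → ℤ) (k : ℕ) (P : Finset (Finset ε)) (e : ε)
    (he : ∀ 𝓕 : Fin (k + 1) → Finset ε, (∀ i, 𝓕 i ∈ P) →
      (Pairwise fun i j => Disjoint (𝓕 i) (𝓕 j)) → ∃ i, e ∈ 𝓕 i) :
    packingSum w (k + 1) P =
      (k + 1 : ℕ) * ∑ F ∈ P with e ∈ F, w F * packingSum w k {F' ∈ P | Disjoint F F'} := by
  set T : Finset (Fin (k + 1) → Finset ε) :=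
    {𝓕 | (∀ i, 𝓕 i ∈ P) ∧ Pairwise fun i j => Disjoint (𝓕 i) (𝓕 j)} with hT
  have hsplit : packingSum w (k + 1) P =
      ∑ i, ∑ 𝓕 ∈ T with e ∈ 𝓕 i, ∏ j, w (𝓕 j) := by
    simp_rw [Finset.sum_filter _ (_ : (Fin (k + 1) → Finset ε) → ℤ)]
    rw [Finset.sum_comm]
    refine Finset.sum_congr rfl fun 𝓕 h𝓕 => ?_
    obtain ⟨hP, hd⟩ := (Finset.mem_filter.mp h𝓕).2
    obtain ⟨i, hi⟩ := he 𝓕 hP hd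
    rw [Finset.sum_eq_single i]
    · rw [if_pos hi]
    · intro j _ hj
      exact if_neg fun hej => Finset.disjoint_left.mp (hd hj) hej hi
    · simp
  have hswap (i : Fin (k + 1)) : ∑ 𝓕 ∈ T with e ∈ 𝓕 i, ∏ j, w (𝓕 j) =
      ∑ 𝓕 ∈ T with e ∈ 𝓕 0, ∏ j, w (𝓕 j) := by
    have hperm (𝓕 : Fin (k + 1) → Finset ε) (h : 𝓕 ∈ T) : 𝓕 ∘ Equiv.swap 0 i ∈ T := by
      obtain ⟨hP, hd⟩ := (Finset.mem_filter.mp h).2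
      exact Finset.mem_filter.mpr ⟨Finset.mem_univ _, fun j => hP _,
        fun j l hjl => hd ((Equiv.swap 0 i).injective.ne hjl)⟩
    refine Finset.sum_bij' (fun 𝓕 _ => 𝓕 ∘ Equiv.swap 0 i) (fun 𝓕 _ => 𝓕 ∘ Equiv.swap 0 i)
      ?_ ?_ ?_ ?_ ?_
    · intro 𝓕 h
      rw [Finset.mem_filter] at h ⊢
      exact ⟨hperm 𝓕 h.1, by simpa using h.2⟩
    · intro 𝓕 h
      rw [Finset.mem_filter] at h ⊢
      exact ⟨hperm 𝓕 h.1, by simpa using h.2⟩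
    · intro 𝓕 _
      ext1 j
      simp
    · intro 𝓕 _
      ext1 j
      simp
    · intro 𝓕 _
      exact (Equiv.prod_comp (Equiv.swap 0 i) fun j => w (𝓕 j)).symm
  have hcons : ∑ 𝓕 ∈ T with e ∈ 𝓕 0, ∏ j, w (𝓕 j) =
      ∑ F ∈ P with e ∈ F, w F * packingSum w k {F' ∈ P | Disjoint F F'} := by
    simp_rw [packingSum, Finset.mul_sum]
    rw [Finset.sum_sigma']
    refine Finset.sum_bij' (fun 𝓕 _ => ⟨𝓕 0, Fin.tail 𝓕⟩) (fun x _ => Fin.cons x.1 x.2)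
      ?_ ?_ ?_ ?_ ?_
    · intro 𝓕 h
      simp only [hT, Finset.mem_filter, Finset.mem_univ, true_and, Finset.mem_sigma] at h ⊢
      exact ⟨⟨h.1.1 0, h.2⟩, fun i => ⟨h.1.1 _, h.1.2 (Fin.succ_ne_zero i).symm⟩,
        fun i j hij => h.1.2 ((Fin.succ_injective k).ne hij)⟩
    · rintro ⟨F, 𝓕⟩ h
      simp only [hT, Finset.mem_filter, Finset.mem_univ, true_and, Finset.mem_sigma] at h ⊢
      refine ⟨⟨Fin.cases h.1.1 fun i => (h.2.1 i).1, ?_⟩, h.1.2⟩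
      intro i j
      refine Fin.cases ?_ (fun i => ?_) i <;> refine Fin.cases ?_ (fun j => ?_) j
      · simp
      · intro _
        exact (h.2.1 j).2
      · intro _
        exact (h.2.1 i).2.symm
      · intro hij
        exact h.2.2 fun h' => hij (congrArg _ h')
    · intro 𝓕 _
      exact Fin.cons_self_tail 𝓕
    · rintro ⟨F, 𝓕⟩ _
      rfl
    · intro 𝓕 _
      exact Fin.prod_univ_succ _
  rw [hsplit, Finset.sum_congr rfl fun i _ => hswap i, hcons]
  simp

lemma packingSum_eq_factorial_mul (w : Finset ε → ℤ) (es : List ε) (hes : es.Nodup)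
    (P : Finset (Finset ε)) (hP : ∀ F ∈ P, ∃! e, e ∈ es ∧ e ∈ F) :
    packingSum w es.length P = es.length.factorial * transversalSum w es P := by
  induction es generalizing P with
  | nil =>
    have hP' : P = ∅ := Finset.eq_empty_of_forall_notMem fun F hF => by
      simpa using (hP F hF).exists
    simp [packingSum, transversalSum, Pairwise]
  | cons e es ih =>
    obtain ⟨he, hes'⟩ := List.nodup_cons.mp hes
    rw [List.length_cons, packingSum_succ w es.length P e fun 𝓕 h𝓕 hd =>
      exists_mem_of_pairwise_disjoint hes rfl hP h𝓕 hd List.mem_cons_self,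
      transversalSum, Nat.factorial_succ, Finset.mul_sum, Finset.mul_sum]
    refine Finset.sum_congr rfl fun F hF => ?_
    rw [ih hes']
    · push_cast
      ring
    · intro F' hF'
      have heF' : e ∉ F' := Finset.disjoint_left.mp (Finset.mem_filter.mp hF').2
        (Finset.mem_filter.mp hF).2
      obtain ⟨x, ⟨hx, hxF'⟩, hux⟩ := hP F' (Finset.mem_filter.mp hF').1
      refine ⟨x, ⟨(List.mem_cons.mp hx).resolve_left ?_, hxF'⟩, fun y hy =>
        hux y ⟨List.mem_cons_of_mem _ hy.1, hy.2⟩⟩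
      rintro rfl
      exact heF' hxF'

end PackingSum

/-! ### Evaluating transversal sums on bit masks

The functions below are written with recursors and in continuation-passing style, so that the
kernel evaluates their arguments before using them. -/

section BitMasks

/-- Pass to `k` the list of those `q ∈ P` whose mask `q.1` is disjoint from `m`. -/
def filterDisjoint {β : Type} (m : ℕ) (P : List (ℕ × ℕ)) :
    List (ℕ × ℕ) → (List (ℕ × ℕ) → β) → β :=
  List.rec (fun acc k => k acc) (fun q _ ih acc k =>
    Nat.rec (ih (q :: acc) k) (fun _ _ => ih acc k) (Nat.land m q.1)) P

/-- Pass to `k` the list of those `q ∈ P` whose mask `q.1` meets `m`, and the list of the other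
members of `P`. -/
def partitionDisjoint {β : Type} (m : ℕ) (P : List (ℕ × ℕ)) :
    List (ℕ × ℕ) → List (ℕ × ℕ) → (List (ℕ × ℕ) → List (ℕ × ℕ) → β) → β :=
  List.rec (fun acc acc' k => k acc acc') (fun q _ ih acc acc' k =>
    Nat.rec (ih acc (q :: acc') k) (fun _ _ => ih (q :: acc) acc' k) (Nat.land m q.1)) P

/-- Apply `f` to the value of `n`. -/
def evalNat {β : Type} (n : ℕ) (f : ℕ → β) : β :=
  Nat.rec (f 0) (fun k _ => f (k + 1)) n

/-- Pass the evaluated list `P`, in reverse order, to `k`. -/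
def evalList {β : Type} (P : List (ℕ × ℕ)) : List (ℕ × ℕ) → (List (ℕ × ℕ) → β) → β :=
  List.rec (fun acc k => k acc) (fun q _ ih acc k =>
    evalNat q.1 fun a => evalNat q.2 fun b => ih ((a, b) :: acc) k) P

/-- The sum of `q.2 * f q.1` over the members `q` of a list. -/
def weightedSum (f : ℕ → ℕ) (A : List (ℕ × ℕ)) : ℕ :=
  List.rec 0 (fun q _ ih => Nat.add (Nat.mul q.2 (f q.1)) ih) A

/-- The transversal sum of a list of pairs of a mask and a weight. -/
def maskSum (bs : List ℕ) : List (ℕ × ℕ) → ℕ :=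
  List.rec (fun _ => 1) (fun b _ ih P =>
    partitionDisjoint b P [] [] fun A B => weightedSum (fun m => filterDisjoint m B [] ih) A) bs

lemma filterDisjoint_eq {β : Type} (m : ℕ) (P acc : List (ℕ × ℕ)) (k : List (ℕ × ℕ) → β) :
    filterDisjoint m P acc k = k ((P.filter fun q => m &&& q.1 = 0).reverse ++ acc) := by
  induction P generalizing acc with
  | nil => rfl
  | cons q P ih =>
    change Nat.rec (motive := fun _ => β) (filterDisjoint m P (q :: acc) k)
      (fun _ _ => filterDisjoint m P acc k) (m &&& q.1) = _
    rw [ih, ih]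
    cases h : m &&& q.1 <;> simp [h]

lemma partitionDisjoint_eq {β : Type} (m : ℕ) (P acc acc' : List (ℕ × ℕ))
    (k : List (ℕ × ℕ) → List (ℕ × ℕ) → β) :
    partitionDisjoint m P acc acc' k =
      k ((P.filter fun q => m &&& q.1 ≠ 0).reverse ++ acc)
        ((P.filter fun q => m &&& q.1 = 0).reverse ++ acc') := by
  induction P generalizing acc acc' with
  | nil => rfl
  | cons q P ih =>
    change Nat.rec (motive := fun _ => β) (partitionDisjoint m P acc (q :: acc') k)
      (fun _ _ => partitionDisjoint m P (q :: acc) acc' k) (m &&& q.1) = _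
    rw [ih, ih]
    cases h : m &&& q.1 <;> simp [h]

lemma evalNat_eq {β : Type} (n : ℕ) (f : ℕ → β) : evalNat n f = f n := by
  cases n <;> rfl

lemma evalList_eq {β : Type} (P acc : List (ℕ × ℕ)) (k : List (ℕ × ℕ) → β) :
    evalList P acc k = k (P.reverse ++ acc) := by
  induction P generalizing acc with
  | nil => rfl
  | cons q P ih =>
    change evalNat q.1 (fun a => evalNat q.2 fun b => evalList P ((a, b) :: acc) k) = _
    simp [evalNat_eq, ih]

lemma weightedSum_eq (f : ℕ → ℕ) (A : List (ℕ × ℕ)) :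
    weightedSum f A = (A.map fun q => q.2 * f q.1).sum := by
  induction A with
  | nil => rfl
  | cons q A ih =>
    change q.2 * f q.1 + weightedSum f A = _
    simp [ih]

lemma maskSum_cons (b : ℕ) (bs : List ℕ) (P : List (ℕ × ℕ)) :
    maskSum (b :: bs) P = ((P.filter fun q => b &&& q.1 ≠ 0).reverse.map fun q =>
      q.2 * maskSum bs (((P.filter fun q => b &&& q.1 = 0).reverse.filter
        fun q' => q.1 &&& q'.1 = 0).reverse)).sum := by
  change partitionDisjoint b P [] [] (fun A B =>
    weightedSum (fun m => filterDisjoint m B [] (maskSum bs)) A) = _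
  simp only [partitionDisjoint_eq, weightedSum_eq, filterDisjoint_eq, List.append_nil]

/-- If masks represent sets faithfully and the weights agree modulo `r`, then `maskSum` computes
`transversalSum` modulo `r`. -/
lemma maskSum_eq_transversalSum {ε : Type*} [DecidableEq ε] (r : ℕ) (w : Finset ε → ℤ)
    (D : ℕ × ℕ → Finset ε) (good : ℕ × ℕ → Prop)
    (hw : ∀ q, good q → (q.2 : ZMod r) = w (D q))
    (hD : ∀ p q, good p → good q → (p.1 &&& q.1 = 0 ↔ Disjoint (D p) (D q)))
    (c : ε → ℕ) (hc : ∀ e q, good q → (c e &&& q.1 = 0 ↔ e ∉ D q))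
    (es : List ε) (P : List (ℕ × ℕ)) (hgood : ∀ q ∈ P, good q) (hP : (P.map D).Nodup) :
    (maskSum (es.map c) P : ZMod r) = transversalSum w es (P.map D).toFinset := by
  induction es generalizing P with
  | nil => simp [maskSum, transversalSum]
  | cons e es ih =>
    have hfilter : {F ∈ (P.map D).toFinset | e ∈ F} =
        ((P.filter fun q => c e &&& q.1 ≠ 0).reverse.map D).toFinset := by
      ext F
      simp only [Finset.mem_filter, List.mem_toFinset, List.mem_map, List.mem_reverse,
        List.mem_filter, decide_eq_true_eq]
      constructor
      · rintro ⟨⟨q, hq, rfl⟩, he⟩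
        exact ⟨q, ⟨hq, fun h => (hc e q (hgood q hq)).mp h he⟩, rfl⟩
      · rintro ⟨q, ⟨hq, h⟩, rfl⟩
        exact ⟨⟨q, hq, rfl⟩, by_contra fun he => h ((hc e q (hgood q hq)).mpr he)⟩
    have hnodup : ((P.filter fun q => c e &&& q.1 ≠ 0).reverse.map D).Nodup := by
      rw [List.map_reverse, List.nodup_reverse]
      exact hP.sublist (List.filter_sublist.map D)
    rw [List.map_cons, maskSum_cons, transversalSum, hfilter, List.sum_toFinset _ hnodup,
      Nat.cast_list_sum, Int.cast_list_sum, List.map_map, List.map_map, List.map_map]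
    congr 1
    refine List.map_congr_left fun q hq => ?_
    obtain ⟨hqP, hqe⟩ : q ∈ P ∧ c e &&& q.1 ≠ 0 := by simpa using hq
    have heq : e ∈ D q := by_contra fun h => hqe ((hc e q (hgood q hqP)).mpr h)
    simp only [Function.comp_apply, Nat.cast_mul, Int.cast_mul, hw q (hgood q hqP)]
    congr 1
    rw [ih]
    · congr 2
      ext F
      simp only [Finset.mem_filter, List.mem_toFinset, List.mem_map, List.mem_reverse,
        List.mem_filter, decide_eq_true_eq]
      constructor
      · rintro ⟨q', ⟨⟨hq', -⟩, h⟩, rfl⟩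
        exact ⟨⟨q', hq', rfl⟩, (hD q q' (hgood q hqP) (hgood q' hq')).mp h⟩
      · rintro ⟨⟨q', hq', rfl⟩, h⟩
        exact ⟨q', ⟨⟨hq', (hc e q' (hgood q' hq')).mpr (Finset.disjoint_left.mp h heq)⟩,
          (hD q q' (hgood q hqP) (hgood q' hq')).mpr h⟩, rfl⟩
    · intro q' hq'
      simp only [List.mem_reverse, List.mem_filter] at hq'
      exact hgood q' hq'.1.1
    · rw [← List.filter_reverse, List.reverse_reverse]
      exact hP.sublist ((List.filter_sublist.trans List.filter_sublist).map D)

end BitMasks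

/-! ### Enumerating perfect matchings -/

section Matchings

variable {V : Type*} [DecidableEq V]

/-- The perfect matchings of the vertices in a list of length at most `2 * n` by edges in `E`. -/
def listMatchings (E : List (Sym2 V)) : ℕ → List V → List (List (Sym2 V))
  | 0, _ => [[]]
  | _ + 1, [] => [[]]
  | n + 1, v :: vs => (vs.filter fun w => s(v, w) ∈ E).flatMap fun w =>
      (listMatchings E n (vs.erase w)).map (s(v, w) :: ·)

/-- The set `F` of edges matches up the vertices in `U` by edges in `E`. -/
def IsMatchingOn (E : List (Sym2 V)) (U : List V) (F : Finset (Sym2 V)) : Prop :=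
  (∀ e ∈ F, e ∈ E ∧ ∀ v ∈ e, v ∈ U) ∧ ∀ v ∈ U, ∃! e, e ∈ F ∧ v ∈ e

omit [DecidableEq V] in
lemma isMatchingOn_nil {E : List (Sym2 V)} {F : Finset (Sym2 V)} :
    IsMatchingOn E [] F ↔ F = ∅ := by
  constructor
  · rintro ⟨h, -⟩
    refine Finset.eq_empty_of_forall_notMem fun e he => ?_
    induction e with
    | h a b => simpa using (h _ he).2 a (Sym2.mem_mk_left a b)
  · rintro rfl
    simp [IsMatchingOn]

lemma isMatchingOn_insert {E : List (Sym2 V)} {v w : V} {vs : List V} {F : Finset (Sym2 V)}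
    (hvs : (v :: vs).Nodup) (hw : w ∈ vs) (hvw : s(v, w) ∈ E)
    (hF : IsMatchingOn E (vs.erase w) F) :
    IsMatchingOn E (v :: vs) (insert s(v, w) F) := by
  obtain ⟨hv, hvs⟩ := List.nodup_cons.mp hvs
  have hmem {x : V} : x ∈ vs.erase w ↔ x ≠ w ∧ x ∈ vs := hvs.mem_erase_iff
  constructor
  · intro e he
    rcases Finset.mem_insert.mp he with rfl | he
    · exact ⟨hvw, by simp [hw]⟩
    · exact ⟨(hF.1 e he).1, fun x hx => List.mem_cons_of_mem _ (hmem.mp ((hF.1 e he).2 x hx)).2⟩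
  · intro x hx
    by_cases hxvw : x ∈ s(v, w)
    · refine ⟨s(v, w), ⟨Finset.mem_insert_self _ _, hxvw⟩, ?_⟩
      rintro e ⟨he, hxe⟩
      rcases Finset.mem_insert.mp he with rfl | he
      · rfl
      · have := hmem.mp ((hF.1 e he).2 x hxe)
        rcases Sym2.mem_iff.mp hxvw with rfl | rfl
        · exact absurd this.2 hv
        · exact absurd rfl this.1
    · simp only [Sym2.mem_iff, not_or] at hxvw
      obtain ⟨e, ⟨he, hxe⟩, hu⟩ := hF.2 x
        (hmem.mpr ⟨hxvw.2, (List.mem_cons.mp hx).resolve_left hxvw.1⟩)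
      refine ⟨e, ⟨Finset.mem_insert_of_mem he, hxe⟩, ?_⟩
      rintro e' ⟨he', hxe'⟩
      rcases Finset.mem_insert.mp he' with rfl | he'
      · simp [hxvw] at hxe'
      · exact hu e' ⟨he', hxe'⟩

lemma IsMatchingOn.exists_erase {E : List (Sym2 V)} (hE : ∀ e ∈ E, ¬ e.IsDiag) {v : V}
    {vs : List V} {F : Finset (Sym2 V)} (hvs : (v :: vs).Nodup) (hF : IsMatchingOn E (v :: vs) F) :
    ∃ w ∈ vs, s(v, w) ∈ E ∧ s(v, w) ∈ F ∧ IsMatchingOn E (vs.erase w) (F.erase s(v, w)) := by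
  obtain ⟨hv, hvs⟩ := List.nodup_cons.mp hvs
  obtain ⟨e, ⟨he, hve⟩, hu⟩ := hF.2 v List.mem_cons_self
  obtain ⟨w, rfl⟩ := Sym2.mem_iff_exists.mp hve
  have hne : v ≠ w := fun h => hE _ (hF.1 _ he).1 (Sym2.mk_isDiag_iff.mpr h)
  have hw : w ∈ vs := (List.mem_cons.mp ((hF.1 _ he).2 w (Sym2.mem_mk_right v w))).resolve_left
    hne.symm
  have hmem {x : V} : x ∈ vs.erase w ↔ x ≠ w ∧ x ∈ vs := hvs.mem_erase_iff
  obtain ⟨_, -, huw⟩ := hF.2 w (List.mem_cons_of_mem _ hw)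
  refine ⟨w, hw, (hF.1 _ he).1, he, ?_, ?_⟩
  · intro e' he'
    rw [Finset.mem_erase] at he'
    obtain ⟨hne', he'⟩ := he'
    refine ⟨(hF.1 e' he').1, fun x hx => hmem.mpr ⟨?_, ?_⟩⟩
    · rintro rfl
      exact hne' ((huw e' ⟨he', hx⟩).trans (huw _ ⟨he, Sym2.mem_mk_right v x⟩).symm)
    · refine (List.mem_cons.mp ((hF.1 e' he').2 x hx)).resolve_left ?_
      rintro rfl
      exact hne' (hu e' ⟨he', hx⟩)
  · intro x hx
    obtain ⟨hxw, hx⟩ := hmem.mp hx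
    obtain ⟨e', ⟨he', hxe'⟩, hu'⟩ := hF.2 x (List.mem_cons_of_mem _ hx)
    refine ⟨e', ⟨Finset.mem_erase.mpr ⟨?_, he'⟩, hxe'⟩, fun y hy =>
      hu' y ⟨Finset.mem_of_mem_erase hy.1, hy.2⟩⟩
    rintro rfl
    rcases Sym2.mem_iff.mp hxe' with rfl | rfl
    · exact hv hx
    · exact hxw rfl

lemma isMatchingOn_toFinset {E : List (Sym2 V)} {n : ℕ} {U : List V} (hU : U.Nodup)
    (hn : U.length ≤ 2 * n) {l : List (Sym2 V)} (hl : l ∈ listMatchings E n U) :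
    IsMatchingOn E U l.toFinset ∧ l.Nodup := by
  induction n generalizing U l with
  | zero =>
    obtain rfl : U = [] := List.length_eq_zero_iff.mp (by omega)
    obtain rfl : l = [] := by simpa [listMatchings] using hl
    simp [isMatchingOn_nil]
  | succ n ih =>
    cases U with
    | nil =>
      obtain rfl : l = [] := by simpa [listMatchings] using hl
      simp [isMatchingOn_nil]
    | cons v vs =>
      simp only [listMatchings, List.mem_flatMap, List.mem_filter, decide_eq_true_eq,
        List.mem_map] at hl
      obtain ⟨w, ⟨hw, hvw⟩, l, hl, rfl⟩ := hl
      have hlen := List.length_erase_of_mem hw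
      rw [List.length_cons] at hn
      obtain ⟨hF, hl⟩ := ih ((List.nodup_cons.mp hU).2.erase w) (by omega) hl
      refine ⟨?_, List.nodup_cons.mpr ⟨fun h => ?_, hl⟩⟩
      · rw [List.toFinset_cons]
        exact isMatchingOn_insert hU hw hvw hF
      · exact (List.nodup_cons.mp hU).1 (List.mem_of_mem_erase
          ((hF.1 _ (List.mem_toFinset.mpr h)).2 v (Sym2.mem_mk_left v w)))

lemma exists_mem_listMatchings {E : List (Sym2 V)} (hE : ∀ e ∈ E, ¬ e.IsDiag) {n : ℕ}
    {U : List V} (hU : U.Nodup) (hn : U.length ≤ 2 * n) {F : Finset (Sym2 V)}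
    (hF : IsMatchingOn E U F) : ∃ l ∈ listMatchings E n U, l.toFinset = F := by
  induction n generalizing U F with
  | zero =>
    obtain rfl : U = [] := List.length_eq_zero_iff.mp (by omega)
    simp [listMatchings, isMatchingOn_nil.mp hF]
  | succ n ih =>
    cases U with
    | nil => simp [listMatchings, isMatchingOn_nil.mp hF]
    | cons v vs =>
      obtain ⟨w, hw, hvw, hmem, hF'⟩ := hF.exists_erase hE hU
      have hlen := List.length_erase_of_mem hw
      rw [List.length_cons] at hn
      obtain ⟨l, hl, hlF⟩ := ih ((List.nodup_cons.mp hU).2.erase w) (by omega) hF'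
      refine ⟨s(v, w) :: l, ?_, ?_⟩
      · simp only [listMatchings, List.mem_flatMap, List.mem_filter, decide_eq_true_eq,
          List.mem_map]
        exact ⟨w, ⟨hw, hvw⟩, l, hl, rfl⟩
      · rw [List.toFinset_cons, hlF, Finset.insert_erase hmem]

lemma nodup_map_toFinset_listMatchings {E : List (Sym2 V)} {n : ℕ} {U : List V} (hU : U.Nodup)
    (hn : U.length ≤ 2 * n) : ((listMatchings E n U).map List.toFinset).Nodup := by
  induction n generalizing U with
  | zero => simp [listMatchings]
  | succ n ih =>
    cases U with
    | nil => simp [listMatchings]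
    | cons v vs =>
      obtain ⟨hv, hvs⟩ := List.nodup_cons.mp hU
      rw [List.length_cons] at hn
      have hlen {w : V} (hw : w ∈ vs) : (vs.erase w).length ≤ 2 * n := by
        have := List.length_erase_of_mem hw
        omega
      have hnot {w : V} (hw : w ∈ vs) {l : List (Sym2 V)}
          (hl : l ∈ listMatchings E n (vs.erase w)) (x : V) : s(v, x) ∉ l := fun h =>
        hv (List.mem_of_mem_erase (((isMatchingOn_toFinset (hvs.erase w) (hlen hw) hl).1.1 _
          (List.mem_toFinset.mpr h)).2 v (Sym2.mem_mk_left v x)))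
      rw [listMatchings, List.map_flatMap, List.nodup_flatMap]
      constructor
      · intro w hw
        replace hw := (List.mem_filter.mp hw).1
        have hnodup := ih (hvs.erase w) (hlen hw)
        rw [List.map_map]
        rw [List.Nodup, List.pairwise_map] at hnodup ⊢
        refine hnodup.imp_of_mem fun {l l'} hl hl' hne heq => hne ?_
        simp only [Function.comp_apply, List.toFinset_cons] at heq
        rw [← Finset.erase_insert (mt List.mem_toFinset.mp (hnot hw hl w)), heq,
          Finset.erase_insert (mt List.mem_toFinset.mp (hnot hw hl' w))]
      · refine (hvs.filter _).imp_of_mem fun {w w'} hw hw' hne => ?_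
        replace hw' := (List.mem_filter.mp hw').1
        rw [Function.onFun, List.disjoint_left]
        intro F hF hF'
        simp only [List.map_map, List.mem_map, Function.comp_apply, List.toFinset_cons] at hF hF'
        obtain ⟨l, -, rfl⟩ := hF
        obtain ⟨l', hl', heq⟩ := hF'
        have hmem : s(v, w) ∈ insert s(v, w') l'.toFinset := heq ▸ Finset.mem_insert_self _ _
        rcases Finset.mem_insert.mp hmem with h | h
        · exact hne (Sym2.congr_right.mp h)
        · exact hnot hw' hl' w (List.mem_toFinset.mp h)

end Matchings

/-! ### Signs and masks of lists of edges -/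

section EdgeLists

variable {m : ℕ}

/-- A decision procedure for `crosses`. -/
def crossesBool (e f : Sym2 (Fin m)) : Bool :=
  e.inf < f.inf && f.inf < e.sup && e.sup < f.sup

lemma crossesBool_iff (e f : Sym2 (Fin m)) : crossesBool e f = true ↔ crosses e f := by
  constructor
  · intro h
    simp only [crossesBool, Bool.and_eq_true, decide_eq_true_eq] at h
    exact ⟨e.inf, f.inf, e.sup, f.sup, (Sym2.sortEquiv.left_inv e).symm,
      (Sym2.sortEquiv.left_inv f).symm, h.1.1, h.1.2, h.2⟩
  · rintro ⟨a, b, c, d, rfl, rfl, hab, hbc, hcd⟩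
    simp [crossesBool, (hab.trans hbc).le, (hbc.trans hcd).le, hab, hbc, hcd]

/-- The number of crossings in a list of edges. -/
def crossingNumber (l : List (Sym2 (Fin m))) : ℕ :=
  (l.map fun e => l.countP (crossesBool e)).sum

lemma matchingSign_toFinset {l : List (Sym2 (Fin m))} (hl : l.Nodup) :
    matchingSign l.toFinset = (-1) ^ crossingNumber l := by
  rw [matchingSign, crossingNumber]
  congr 1
  rw [Finset.card_filter, Finset.sum_product, List.sum_toFinset _ hl]
  congr 1
  refine List.map_congr_left fun e _ => ?_
  rw [← Finset.card_filter, List.countP_eq_length_filter,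
    ← List.toFinset_card_of_nodup (hl.filter _)]
  congr 1
  ext f
  simp [crossesBool_iff]

/-- A residue modulo `5` of the sign of a list of edges. -/
def signResidue (l : List (Sym2 (Fin m))) : ℕ :=
  if crossingNumber l % 2 = 0 then 1 else 4

lemma signResidue_eq {l : List (Sym2 (Fin m))} (hl : l.Nodup) :
    (signResidue l : ZMod 5) = matchingSign l.toFinset := by
  rw [matchingSign_toFinset hl, signResidue]
  rcases Nat.mod_two_eq_zero_or_one (crossingNumber l) with h | h
  · rw [if_pos h, (Nat.even_iff.mpr h).neg_one_pow]
    rfl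
  · rw [if_neg (by omega), (Nat.odd_iff.mpr h).neg_one_pow]
    rfl

/-- The position of the bit that represents an edge. -/
def edgeCode (e : Sym2 (Fin m)) : ℕ := m * e.inf.val + e.sup.val

lemma edgeCode_injective : Function.Injective (edgeCode (m := m)) := by
  intro e f h
  have hsup : e.sup = f.sup := by
    have := congrArg (· % m) h
    simp only [edgeCode, Nat.mul_add_mod, Nat.mod_eq_of_lt (Fin.is_lt _)] at this
    exact Fin.ext this
  have hinf : e.inf = f.inf := by
    rw [edgeCode, edgeCode, hsup, Nat.add_right_cancel_iff] at h
    exact Fin.ext (Nat.eq_of_mul_eq_mul_left (Fin.pos e.inf) h)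
  exact Sym2.inf_eq_inf_and_sup_eq_sup.mp ⟨hinf, hsup⟩

/-- The bit mask of a list of edges. -/
def edgeMask (l : List (Sym2 (Fin m))) : ℕ := l.foldr (fun e x => 2 ^ edgeCode e ||| x) 0

lemma testBit_edgeMask (l : List (Sym2 (Fin m))) (i : ℕ) :
    (edgeMask l).testBit i = true ↔ ∃ e ∈ l, edgeCode e = i := by
  induction l with
  | nil => simp [edgeMask]
  | cons e l ih =>
    change (2 ^ edgeCode e ||| edgeMask l).testBit i = true ↔ _
    simp [Nat.testBit_or, Nat.testBit_two_pow, ih]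

/-- The set of edges represented by a bit mask. -/
def maskEdges (x : ℕ) : Finset (Sym2 (Fin m)) := {e | x.testBit (edgeCode e) = true}

lemma maskEdges_edgeMask (l : List (Sym2 (Fin m))) : maskEdges (edgeMask l) = l.toFinset := by
  ext e
  simp [maskEdges, testBit_edgeMask, edgeCode_injective.eq_iff]

lemma edgeMask_land_eq_zero_iff (l l' : List (Sym2 (Fin m))) :
    edgeMask l &&& edgeMask l' = 0 ↔ Disjoint l.toFinset l'.toFinset := by
  rw [Finset.disjoint_left]
  constructor
  · intro h e he he'
    have := congrArg (Nat.testBit · (edgeCode e)) h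
    rw [Nat.testBit_and, Nat.zero_testBit,
      (testBit_edgeMask l _).mpr ⟨e, List.mem_toFinset.mp he, rfl⟩,
      (testBit_edgeMask l' _).mpr ⟨e, List.mem_toFinset.mp he', rfl⟩] at this
    exact Bool.noConfusion this
  · intro h
    refine Nat.eq_of_testBit_eq fun i => ?_
    rw [Nat.zero_testBit, Nat.testBit_and, ← Bool.not_eq_true, Bool.and_eq_true,
      testBit_edgeMask, testBit_edgeMask]
    rintro ⟨⟨e, he, rfl⟩, e', he', heq⟩
    obtain rfl := edgeCode_injective heq
    exact h (List.mem_toFinset.mpr he) (List.mem_toFinset.mpr he')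

end EdgeLists

/-! ### Edges, perfect matchings and factorizations of the graph -/

/-- The edges of `G15'`. -/
def edges15 : List (Sym2 (Fin 12)) :=
  [s(0, 1), s(0, 2), s(0, 3), s(0, 4), s(0, 5), s(0, 11), s(1, 2), s(1, 4), s(1, 6), s(1, 9),
    s(1, 11), s(2, 3), s(2, 6), s(2, 7), s(2, 11), s(3, 4), s(3, 7), s(3, 8), s(3, 11), s(4, 8),
    s(4, 9), s(4, 11), s(5, 6), s(5, 7), s(5, 8), s(5, 9), s(5, 10), s(6, 7), s(6, 9), s(6, 10),
    s(7, 8), s(7, 10), s(8, 9), s(8, 10), s(9, 10), s(10, 11)]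

lemma not_isDiag_of_mem_edges15 : ∀ e ∈ edges15, ¬ e.IsDiag := by decide

lemma mem_edgeSet_G15' (e : Sym2 (Fin 12)) : e ∈ G15'.edgeSet ↔ e ∈ edges15 := by
  have hmem : e ∈ G15'.edgeSet ↔ e ∈ edges15 ∧ ¬ e.IsDiag := by
    rw [G15', SimpleGraph.edgeSet_fromEdgeSet]
    simp [edges15]
  rw [hmem, and_iff_left_iff_imp]
  exact not_isDiag_of_mem_edges15 e

/-- The edges of `G15'` at a vertex. -/
def star15 (v : Fin 12) : List (Sym2 (Fin 12)) := edges15.filter fun e => v ∈ e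

lemma nodup_star15 (v : Fin 12) : (star15 v).Nodup := by
  revert v
  decide +kernel

lemma length_star15 (v : Fin 12) : (star15 v).length = 6 := by
  revert v
  decide +kernel

/-- The perfect matchings of `G15'`. -/
def matchings15 : List (List (Sym2 (Fin 12))) := listMatchings edges15 6 (List.finRange 12)

lemma nodup_of_mem_matchings15 {l : List (Sym2 (Fin 12))} (hl : l ∈ matchings15) : l.Nodup :=
  (isMatchingOn_toFinset (List.nodup_finRange 12) (by simp) hl).2

lemma mem_matchings15_iff (F : Finset (Sym2 (Fin 12))) :
    F ∈ (matchings15.map List.toFinset).toFinset ↔ IsPerfectMatchingOf G15' F := by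
  have hiff : IsPerfectMatchingOf G15' F ↔ IsMatchingOn edges15 (List.finRange 12) F := by
    simp [IsPerfectMatchingOf, IsMatchingOn, mem_edgeSet_G15']
  rw [hiff, List.mem_toFinset, List.mem_map]
  constructor
  · rintro ⟨l, hl, rfl⟩
    exact (isMatchingOn_toFinset (List.nodup_finRange 12) (by simp) hl).1
  · exact exists_mem_listMatchings not_isDiag_of_mem_edges15 (List.nodup_finRange 12) (by simp)

lemma existsUnique_mem_star15 (v : Fin 12) (F : Finset (Sym2 (Fin 12)))
    (hF : F ∈ (matchings15.map List.toFinset).toFinset) : ∃! e, e ∈ star15 v ∧ e ∈ F := by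
  obtain ⟨hG, hv⟩ := (mem_matchings15_iff F).mp hF
  obtain ⟨e, ⟨heF, hve⟩, hu⟩ := hv v
  refine ⟨e, ⟨List.mem_filter.mpr ⟨(mem_edgeSet_G15' e).mp (hG e heF), by simpa using hve⟩, heF⟩,
    fun f hf => hu f ⟨hf.2, by simpa using (List.mem_filter.mp hf.1).2⟩⟩

lemma isOrderedOneFactorization_G15'_iff (𝓕 : Fin 6 → Finset (Sym2 (Fin 12))) :
    IsOrderedOneFactorization G15' 𝓕 ↔
      (∀ i, 𝓕 i ∈ (matchings15.map List.toFinset).toFinset) ∧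
        Pairwise fun i j => Disjoint (𝓕 i) (𝓕 j) := by
  simp only [mem_matchings15_iff, IsOrderedOneFactorization]
  refine and_congr_right fun hM => ⟨fun h i j hij => ?_, fun hd e => ⟨fun he => ?_, ?_⟩⟩
  · refine Finset.disjoint_left.mpr fun e hi hj => ?_
    exact hij (((h e).mp ((hM i).1 e hi)).unique hi hj)
  · obtain ⟨v, hv⟩ : ∃ v, v ∈ e := ⟨_, e.out_fst_mem⟩
    obtain ⟨i, hi⟩ := exists_mem_of_pairwise_disjoint (nodup_star15 v) (length_star15 v)
      (existsUnique_mem_star15 v) (fun i => (mem_matchings15_iff _).mpr (hM i)) hd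
      (List.mem_filter.mpr ⟨(mem_edgeSet_G15' e).mp he, by simpa using hv⟩)
    refine ⟨i, hi, fun j hj => ?_⟩
    by_contra hne
    exact Finset.disjoint_left.mp (hd hne) hj hi
  · rintro ⟨i, hi, -⟩
    exact (hM i).1 e hi

lemma factorizationSignSum_G15' : factorizationSignSum 6 G15' =
    Nat.factorial 6 * transversalSum matchingSign (star15 0)
      (matchings15.map List.toFinset).toFinset := by
  have h := packingSum_eq_factorial_mul matchingSign (star15 0) (nodup_star15 0)
    (matchings15.map List.toFinset).toFinset (existsUnique_mem_star15 0)
  rw [length_star15] at h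
  rw [← h, factorizationSignSum, packingSum]
  simp only [isOrderedOneFactorization_G15'_iff]

/-- The masks of the perfect matchings of `G15'`, with their signs modulo `5`. -/
def masks15 : List (ℕ × ℕ) := matchings15.map fun l => (edgeMask l, signResidue l)

lemma maskSum_masks15 :
    evalList masks15 [] (maskSum [2, 4, 8, 16, 32, 2048]) % 5 = 1 := by
  decide +kernel

lemma transversalSum_G15' : ((transversalSum matchingSign (star15 0)
    (matchings15.map List.toFinset).toFinset : ℤ) : ZMod 5) = 1 := by
  have hmap : masks15.reverse.map (fun q => maskEdges q.1) =
      (matchings15.map List.toFinset).reverse := by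
    simp [masks15, Function.comp_def, maskEdges_edgeMask]
  have h := maskSum_eq_transversalSum 5 matchingSign (fun q => maskEdges (m := 12) q.1)
    (fun q => ∃ l : List (Sym2 (Fin 12)), l.Nodup ∧ (edgeMask l, signResidue l) = q)
    (by
      rintro _ ⟨l, hl, rfl⟩
      simpa only [maskEdges_edgeMask] using signResidue_eq hl)
    (by
      rintro _ _ ⟨l, -, rfl⟩ ⟨l', -, rfl⟩
      simpa only [maskEdges_edgeMask] using edgeMask_land_eq_zero_iff l l')
    (fun e => edgeMask [e])
    (by
      rintro e _ ⟨l, -, rfl⟩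
      simpa [maskEdges_edgeMask] using edgeMask_land_eq_zero_iff [e] l)
    (star15 0) masks15.reverse
    (by
      intro q hq
      obtain ⟨l, hl, rfl⟩ := List.mem_map.mp (List.mem_reverse.mp hq)
      exact ⟨l, nodup_of_mem_matchings15 hl, rfl⟩)
    (by
      rw [hmap, List.nodup_reverse]
      exact nodup_map_toFinset_listMatchings (List.nodup_finRange 12) (by simp))
  have hstar : (star15 0).map (fun e => edgeMask [e]) = [2, 4, 8, 16, 32, 2048] := by
    decide +kernel
  have hmod := maskSum_masks15
  rw [evalList_eq, List.append_nil] at hmod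
  rw [hmap, List.toFinset_reverse, hstar] at h
  rw [← h, ← ZMod.natCast_mod, hmod, Nat.cast_one]

theorem G15'_sign_sum_ne_zero : factorizationSignSum 6 G15' ≠ 0 := by
  rw [factorizationSignSum_G15']
  refine mul_ne_zero (by positivity) fun h => ?_
  have := transversalSum_G15'
  rw [h, Int.cast_zero] at this
  exact absurd this (by decide)
end

section
/- Let G₄′ be the 6-regular simple graph on vertex set {0,1,...,7} with edges given by the adjacency lists: 0 ~ 1,2,3,4,5,6; 1 ~ 0,2,3,4,5,7; 2 ~ 0,1,3,5,6,7; 3 ~ 0,1,2,4,6,7; 4 ~ 0,1,3,5,6,7; 5 ~ 0,1,2,4,6,7; 6 ~ 0,2,3,4,5,7; 7 ~ 1,2,3,4,5,6. Then G₄′ is 6-list-edge-colorable. -/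
open Finset MvPolynomial

namespace G4'

section FiniteDifference

/-- The signed binomial weights of the fifth finite difference. -/
def diffWeight : Fin 6 → ℤ := ![-1, 5, -10, 10, -5, 1]

lemma diffWeight_ne_zero (c : Fin 6) : diffWeight c ≠ 0 := by
  revert c; decide

lemma sum_diffWeight_mul_pow_of_lt {k : ℕ} (hk : k < 5) :
    ∑ c : Fin 6, diffWeight c * (c : ℤ) ^ k = 0 := by
  interval_cases k <;> decide

lemma sum_diffWeight_mul_pow_five : ∑ c : Fin 6, diffWeight c * (c : ℤ) ^ 5 = 120 := by
  decide

/-- The coefficient of `∏ X i ^ 5` in a homogeneous polynomial of the same degree, as an iterated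
finite difference. -/
lemma sum_diffWeight_mul_eval {σ : Type*} [Fintype σ] [DecidableEq σ] {f : MvPolynomial σ ℤ}
    (hf : f.IsHomogeneous (5 * Fintype.card σ)) :
    ∑ x : σ → Fin 6, (∏ i, diffWeight (x i)) * eval (fun i => ((x i : ℕ) : ℤ)) f =
      f.coeff (Finsupp.equivFunOnFinite.symm fun _ => 5) * 120 ^ Fintype.card σ := by
  set t : σ →₀ ℕ := Finsupp.equivFunOnFinite.symm fun _ => 5
  have key (d : σ →₀ ℕ) :
      ∑ x : σ → Fin 6, (∏ i, diffWeight (x i)) * ∏ i, ((x i : ℕ) : ℤ) ^ d i =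
        ∏ i, ∑ c : Fin 6, diffWeight c * (c : ℤ) ^ d i := by
    simp_rw [← prod_mul_distrib, Fintype.prod_sum]
  simp_rw [eval_eq', mul_sum, mul_left_comm _ (coeff _ f)]
  rw [sum_comm]
  simp_rw [← mul_sum, key]
  rw [sum_eq_single t]
  · simp [t, sum_diffWeight_mul_pow_five]
  · intro d hd hdt
    obtain ⟨i, hi⟩ : ∃ i, d i < 5 := by
      by_contra! h
      have hdeg : ∑ i, d i = ∑ _i : σ, 5 := by
        have := hf (mem_support_iff.mp hd)
        rw [Finsupp.weight_apply, Finsupp.sum_fintype _ _ (by simp)] at this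
        simpa [mul_comm] using this
      apply hdt
      ext i
      exact ((sum_eq_sum_iff_of_le fun i _ => h i).mp hdeg.symm i (mem_univ i)).symm
    rw [prod_eq_zero (mem_univ i) (sum_diffWeight_mul_pow_of_lt hi), mul_zero]
  · intro ht
    rw [notMem_support_iff.mp ht, zero_mul]

end FiniteDifference

section Incidence

/-- The edges of `G4'`; the six edges at the vertex `0` come last. -/
def edge : Fin 24 → Sym2 (Fin 8) :=
  ![s(6, 7), s(5, 7), s(5, 6), s(4, 7), s(4, 6), s(4, 5), s(3, 7), s(3, 6), s(3, 4), s(2, 7),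
    s(2, 6), s(2, 5), s(2, 3), s(1, 7), s(1, 5), s(1, 4), s(1, 3), s(1, 2), s(0, 6), s(0, 5),
    s(0, 4), s(0, 3), s(0, 2), s(0, 1)]

/-- `star u` lists the indices of the edges incident to the vertex `u`. -/
def star : Fin 8 → Fin 6 → Fin 24 :=
  ![![18, 19, 20, 21, 22, 23], ![13, 14, 15, 16, 17, 23], ![9, 10, 11, 12, 17, 22],
    ![6, 7, 8, 12, 16, 21], ![3, 4, 5, 8, 15, 20], ![1, 2, 5, 11, 14, 19],
    ![0, 2, 4, 7, 10, 18], ![0, 1, 3, 6, 9, 13]]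

lemma edge_injective : Function.Injective edge := by
  intro i j
  revert i j
  decide +kernel

lemma exists_edge_eq {e : Sym2 (Fin 8)} (he : e ∈ G4'.edgeSet) : ∃ i, edge i = e := by
  rw [G4', SimpleGraph.edgeSet_fromEdgeSet] at he
  have h := he.1
  revert h
  clear he
  simp only [Set.mem_insert_iff, Set.mem_singleton_iff]
  revert e
  decide +kernel

lemma edge_mem_edgeSet (i : Fin 24) : edge i ∈ G4'.edgeSet := by
  rw [G4', SimpleGraph.edgeSet_fromEdgeSet]
  simp only [Set.mem_sdiff, Set.mem_insert_iff, Set.mem_singleton_iff]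
  revert i
  decide +kernel

lemma exists_star_eq {i : Fin 24} {u : Fin 8} (h : u ∈ edge i) : ∃ k, star u k = i := by
  revert i u
  decide +kernel

/-- Every edge lies in exactly two stars. -/
lemma card_star_fiber (i : Fin 24) : #{p : Fin 8 × Fin 6 | star p.1 p.2 = i} = 2 := by
  revert i
  decide +kernel

end Incidence

section StarVandermonde

/-- The product over all vertices of the Vandermonde determinant of the incident edge values. -/
def starVandermonde {R : Type*} [CommRing R] (x : Fin 24 → R) : R :=
  ∏ u, (Matrix.vandermonde fun k => x (star u k)).det

lemma eval_starVandermonde (x : Fin 24 → ℤ) :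
    eval x (starVandermonde (X : Fin 24 → MvPolynomial (Fin 24) ℤ)) = starVandermonde x := by
  simp [starVandermonde, Matrix.det_vandermonde]

lemma isHomogeneous_starVandermonde :
    (starVandermonde (X : Fin 24 → MvPolynomial (Fin 24) ℤ)).IsHomogeneous 120 := by
  have h : (starVandermonde (X : Fin 24 → MvPolynomial (Fin 24) ℤ)).IsHomogeneous
      (∑ _u : Fin 8, ∑ k : Fin 6, ∑ _l ∈ Ioi k, 1) := by
    simp_rw [starVandermonde, Matrix.det_vandermonde]
    exact IsHomogeneous.prod _ _ _ fun u _ => IsHomogeneous.prod _ _ _ fun k _ =>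
      IsHomogeneous.prod _ _ _ fun l _ => (isHomogeneous_X _ _).sub (isHomogeneous_X _ _)
  have hsum : (∑ _u : Fin 8, ∑ k : Fin 6, ∑ _l ∈ Ioi k, 1) = 120 := by decide
  rwa [hsum] at h

lemma starVandermonde_ne_zero_iff {x : Fin 24 → ℤ} :
    starVandermonde x ≠ 0 ↔ ∀ u, Function.Injective fun k => x (star u k) := by
  simp [starVandermonde, prod_ne_zero_iff, Matrix.det_vandermonde_ne_zero_iff]

/-- The value of `starVandermonde` at a coloring with six colors. -/
def colorValue (x : Fin 24 → Fin 6) : ℤ := starVandermonde fun i => ((x i : ℕ) : ℤ)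

lemma bijective_of_colorValue_ne_zero {x : Fin 24 → Fin 6} (h : colorValue x ≠ 0) (u : Fin 8) :
    Function.Bijective fun k => x (star u k) := by
  refine Finite.injective_iff_bijective.mp fun k l hkl => starVandermonde_ne_zero_iff.mp h u ?_
  simpa using congrArg (fun c : Fin 6 => ((c : ℕ) : ℤ)) hkl

/-- In a proper coloring every color occurs four times. -/
lemma card_color_class {x : Fin 24 → Fin 6} (h : colorValue x ≠ 0) (c : Fin 6) :
    #{i | x i = c} = 4 := by
  have h₁ : #{p : Fin 8 × Fin 6 | x (star p.1 p.2) = c} = 8 := by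
    rw [card_filter, Fintype.sum_prod_type]
    have (u : Fin 8) : ∑ k, (if x (star u k) = c then 1 else 0) = 1 := by
      rw [(bijective_of_colorValue_ne_zero h u).sum_comp fun d => if d = c then 1 else 0]
      simp
    simp [this]
  have h₂ : #{p : Fin 8 × Fin 6 | x (star p.1 p.2) = c} = ∑ i with x i = c, 2 := by
    rw [card_eq_sum_card_fiberwise (f := fun p => star p.1 p.2) (t := {i | x i = c})
      (by intro p hp; simpa using hp)]
    refine sum_congr rfl fun i hi => ?_
    rw [← card_star_fiber i, filter_filter]
    congr 1
    ext p
    simp only [mem_filter, mem_univ, true_and] at hi ⊢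
    exact ⟨fun hp => hp.2, fun hp => ⟨hp ▸ hi, hp⟩⟩
  rw [sum_const, smul_eq_mul] at h₂
  omega

lemma prod_diffWeight {x : Fin 24 → Fin 6} (h : colorValue x ≠ 0) :
    ∏ i, diffWeight (x i) = ∏ c, diffWeight c ^ 4 := by
  rw [← prod_fiberwise' univ x diffWeight]
  simp [card_color_class h]

lemma det_vandermonde_perm (π : Equiv.Perm (Fin 6)) (g : Fin 6 → Fin 6) :
    (Matrix.vandermonde fun k => (((π (g k) : Fin 6) : ℕ) : ℤ)).det =
      π.sign * (Matrix.vandermonde fun k => ((g k : ℕ) : ℤ)).det := by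
  set A : Matrix (Fin 6) (Fin 6) ℤ := Matrix.vandermonde fun c => ((c : ℕ) : ℤ)
  set P : Matrix (Fin 6) (Fin 6) ℤ := (1 : Matrix (Fin 6) (Fin 6) ℤ).submatrix g id
  have h (B : Matrix (Fin 6) (Fin 6) ℤ) : B.submatrix g id = P * B := by
    ext i j
    simp [P, Matrix.mul_apply, Matrix.one_apply]
  have h₁ : (Matrix.vandermonde fun k => (((π (g k) : Fin 6) : ℕ) : ℤ)) =
      (A.submatrix π id).submatrix g id := rfl
  have h₂ : (Matrix.vandermonde fun k => ((g k : ℕ) : ℤ)) = A.submatrix g id := rfl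
  rw [h₁, h₂, h, h, Matrix.det_mul, Matrix.det_mul, Matrix.det_permute, Int.cast_id]
  ring

lemma colorValue_perm (π : Equiv.Perm (Fin 6)) (x : Fin 24 → Fin 6) :
    colorValue (fun i => π (x i)) = colorValue x := by
  have h : ((π.sign : ℤˣ) : ℤ) ^ 8 = 1 := by
    rcases Int.units_eq_one_or π.sign with h | h <;> simp [h]
  simp_rw [colorValue, starVandermonde, det_vandermonde_perm, prod_mul_distrib]
  simp [h]

end StarVandermonde

section Search

/-- The sum of `val` over all extensions of the partial coloring `l` by `n` further colors, omitting
the branches rejected by `ok`. -/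
def search (ok : ℕ → ℕ → List ℕ → Bool) (val : List ℕ → ℤ) : ℕ → List ℕ → ℤ
  | 0, l => val l
  | n + 1, l => ([0, 1, 2, 3, 4, 5].map fun c =>
      bif ok n c l then search ok val n (c :: l) else 0).sum

lemma search_eq_sum {ok : ℕ → ℕ → List ℕ → Bool} {val : List ℕ → ℤ}
    (hok : ∀ n c l (y : Fin n → Fin 6), ok n c l = false →
      val (List.ofFn (fun i => (y i : ℕ)) ++ c :: l) = 0) (n : ℕ) (l : List ℕ) :
    search ok val n l = ∑ y : Fin n → Fin 6, val (List.ofFn (fun i => (y i : ℕ)) ++ l) := by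
  induction n generalizing l with
  | zero => simp [search]
  | succ n ih =>
    have hc (c : ℕ) : (bif ok n c l then search ok val n (c :: l) else 0) =
        ∑ y : Fin n → Fin 6, val (List.ofFn (fun i => (y i : ℕ)) ++ c :: l) := by
      cases h : ok n c l with
      | true => simp [ih]
      | false => simp [hok n c l _ h]
    rw [← (Fin.snocEquiv fun _ => Fin 6).sum_comp, Fintype.sum_prod_type]
    have hl (c : Fin 6) (y : Fin n → Fin 6) :
        List.ofFn (fun i => ((Fin.snocEquiv (fun _ => Fin 6) (c, y) i : Fin 6) : ℕ)) ++ l =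
          List.ofFn (fun i => (y i : ℕ)) ++ (c : ℕ) :: l := by
      rw [List.ofFn_succ']
      simp [Fin.snocEquiv]
    simp_rw [hl, ← hc, search]
    simp [Fin.sum_univ_succ]

/-- The Vandermonde product of six values. -/
def vandermondeSix (a b c d e f : ℤ) : ℤ :=
  (b - a) * (c - a) * (d - a) * (e - a) * (f - a) * (c - b) * (d - b) * (e - b) * (f - b) *
    (d - c) * (e - c) * (f - c) * (e - d) * (f - d) * (f - e)

lemma det_vandermonde_six (v : Fin 6 → ℤ) :
    (Matrix.vandermonde v).det = vandermondeSix (v 0) (v 1) (v 2) (v 3) (v 4) (v 5) := by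
  have h : ∀ k : Fin 6, Ioi k = univ.filter fun l => k < l := by decide
  simp_rw [Matrix.det_vandermonde, h, prod_filter, Fin.prod_univ_six]
  simp [vandermondeSix, mul_assoc]

/-- `starVandermonde` of a list of colors, in a form suited to evaluation. -/
def listValue (l : List ℕ) : ℤ :=
  let v (a b c d e f : ℕ) : ℤ :=
    vandermondeSix (l.getD a 0) (l.getD b 0) (l.getD c 0) (l.getD d 0) (l.getD e 0) (l.getD f 0)
  v 18 19 20 21 22 23 * v 13 14 15 16 17 23 * v 9 10 11 12 17 22 * v 6 7 8 12 16 21 *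
    v 3 4 5 8 15 20 * v 1 2 5 11 14 19 * v 0 2 4 7 10 18 * v 0 1 3 6 9 13

lemma listValue_eq (l : List ℕ) :
    listValue l = starVandermonde fun i : Fin 24 => ((l.getD i 0 : ℕ) : ℤ) := by
  simp_rw [starVandermonde, det_vandermonde_six, Fin.prod_univ_eight]
  rfl

/-- Entry `d` of row `n` records that the edges `n` and `n + 1 + d` are adjacent. -/
def laterNeighbors : List (List ℕ) :=
  [[0, 1, 2, 3, 5, 6, 8, 9, 12, 17], [0, 1, 3, 4, 7, 9, 11, 12, 17], [1, 2, 4, 7, 8, 11, 15, 16],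
    [0, 1, 2, 4, 5, 9, 11, 16], [0, 2, 3, 5, 10, 13, 15], [2, 5, 8, 9, 13, 14],
    [0, 1, 2, 5, 6, 9, 14], [0, 2, 4, 8, 10, 13], [3, 6, 7, 11, 12], [0, 1, 2, 3, 7, 12],
    [0, 1, 6, 7, 11], [0, 2, 5, 7, 10], [3, 4, 8, 9], [0, 1, 2, 3, 9], [0, 1, 2, 4, 8],
    [0, 1, 4, 7], [0, 4, 6], [4, 5]]

lemma exists_star_of_mem_laterNeighbors :
    ∀ n < 18, ∀ d ∈ laterNeighbors.getD n [], ∃ u k m,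
      k ≠ m ∧ (star u k : ℕ) = n ∧ (star u m : ℕ) = n + 1 + d := by
  decide +kernel

/-- The edge `n` may get color `c` when `l` lists the colors of the later edges. -/
def admissible (n c : ℕ) (l : List ℕ) : Bool :=
  (laterNeighbors.getD n []).all fun d => !(l.getD d 0).beq c

lemma listValue_eq_zero_of_not_admissible (n c : ℕ) (l : List ℕ) (y : Fin n → Fin 6)
    (h : admissible n c l = false) :
    listValue (List.ofFn (fun i => (y i : ℕ)) ++ c :: l) = 0 := by
  simp only [admissible, List.all_eq_false, Bool.not_eq_true, Bool.not_eq_false'] at h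
  obtain ⟨d, hd, hc⟩ := h
  replace hc := Nat.eq_of_beq_eq_true hc
  have hn : n < 18 := by
    by_contra! hn
    rw [List.getD_eq_default _ _ (by simpa [laterNeighbors] using hn)] at hd
    simp at hd
  obtain ⟨u, k, m, hkm, hk, hm⟩ := exists_star_of_mem_laterNeighbors n hn d hd
  rw [listValue_eq]
  by_contra hne
  refine hkm (starVandermonde_ne_zero_iff.mp hne u ?_)
  simp only [hk, hm]
  rw [List.getD_append_right _ _ _ _ (by simp), List.getD_append_right _ _ _ _ (by simp; omega)]
  have : n + 1 + d - n = d + 1 := by omega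
  simp only [List.length_ofFn, Nat.sub_self, this, List.getD_cons_zero, List.getD_cons_succ, hc]

lemma search_ne_zero : search admissible listValue 18 [0, 1, 2, 3, 4, 5] ≠ 0 := by
  decide +kernel

end Search

lemma comp_append {α β : Type*} {m n : ℕ} (f : α → β) (y : Fin m → α) (z : Fin n → α) :
    (fun i => f (Fin.append y z i)) = Fin.append (fun i => f (y i)) fun i => f (z i) := by
  funext i
  refine Fin.addCases (fun i => ?_) (fun i => ?_) i <;> simp

lemma sum_colorValue_append_ne_zero :
    ∑ y : Fin 18 → Fin 6, colorValue (Fin.append y id) ≠ 0 := by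
  convert search_ne_zero using 1
  rw [search_eq_sum listValue_eq_zero_of_not_admissible]
  refine sum_congr rfl fun y _ => ?_
  have h : List.ofFn (fun i => (y i : ℕ)) ++ [0, 1, 2, 3, 4, 5] =
      List.ofFn (fun i => ((Fin.append y id i : Fin 6) : ℕ)) := by
    rw [comp_append fun c : Fin 6 => (c : ℕ), List.ofFn_fin_append]
    rfl
  rw [h, listValue_eq, colorValue]
  congr 1
  funext i
  rw [List.getD_eq_getElem _ _ (by rw [List.length_ofFn]; exact i.isLt), List.getElem_ofFn]

lemma sum_colorValue_append (g : Fin 6 → Fin 6) :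
    ∑ y : Fin 18 → Fin 6, colorValue (Fin.append y g) =
      if Function.Bijective g then ∑ y : Fin 18 → Fin 6, colorValue (Fin.append y id) else 0 := by
  split_ifs with hg
  · let π := Equiv.ofBijective g hg
    rw [← (Equiv.arrowCongr (Equiv.refl (Fin 18)) π).sum_comp]
    refine sum_congr rfl fun y _ => ?_
    rw [← colorValue_perm π (Fin.append y id)]
    congr 1
    exact (comp_append π y id).symm
  · refine sum_eq_zero fun y _ => ?_
    by_contra h
    refine hg ?_
    convert bijective_of_colorValue_ne_zero h 0 using 1
    funext k
    have : star 0 k = Fin.natAdd 18 k := by revert k; decide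
    rw [this, Fin.append_right]

lemma sum_colorValue_ne_zero : ∑ x, colorValue x ≠ 0 := by
  have h : ∑ x, colorValue x =
      ∑ g : Fin 6 → Fin 6, ∑ y : Fin 18 → Fin 6, colorValue (Fin.append y g) := by
    rw [← Fintype.sum_prod_type_right fun p : (Fin 18 → Fin 6) × (Fin 6 → Fin 6) =>
      colorValue (Fin.append p.1 p.2)]
    exact ((Fin.appendEquiv 18 6).sum_comp colorValue).symm
  rw [h, sum_congr rfl fun g _ => sum_colorValue_append g, ← sum_filter, sum_const, nsmul_eq_mul]
  refine mul_ne_zero (Nat.cast_ne_zero.mpr (card_ne_zero.mpr ⟨id, ?_⟩))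
    sum_colorValue_append_ne_zero
  exact mem_filter.mpr ⟨mem_univ _, Function.bijective_id⟩

lemma coeff_starVandermonde_ne_zero :
    (starVandermonde (X : Fin 24 → MvPolynomial (Fin 24) ℤ)).coeff
      (Finsupp.equivFunOnFinite.symm fun _ => 5) ≠ 0 := by
  have h := sum_diffWeight_mul_eval (σ := Fin 24) isHomogeneous_starVandermonde
  have hw (x : Fin 24 → Fin 6) :
      (∏ i, diffWeight (x i)) *
          eval (fun i => ((x i : ℕ) : ℤ)) (starVandermonde (X : _ → MvPolynomial (Fin 24) ℤ)) =
        (∏ c, diffWeight c ^ 4) * colorValue x := by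
    rw [eval_starVandermonde]
    change _ * colorValue x = _
    by_cases hx : colorValue x = 0
    · simp [hx]
    · rw [prod_diffWeight hx]
  simp_rw [hw, ← mul_sum] at h
  refine left_ne_zero_of_mul (h ▸ mul_ne_zero ?_ sum_colorValue_ne_zero)
  exact prod_ne_zero_iff.mpr fun c _ => pow_ne_zero _ (diffWeight_ne_zero c)

/-- The list coloring statement for integer colors. -/
lemma exists_starVandermonde_ne_zero (S : Fin 24 → Finset ℤ) (hS : ∀ i, 6 ≤ #(S i)) :
    ∃ s : Fin 24 → ℤ, (∀ i, s i ∈ S i) ∧ starVandermonde s ≠ 0 := by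
  have hc := coeff_starVandermonde_ne_zero
  obtain ⟨s, hs, hne⟩ := combinatorial_nullstellensatz_exists_eval_nonzero _ _ hc
    (by
      rw [isHomogeneous_starVandermonde.totalDegree (by rintro h; simp [h] at hc),
        Finsupp.degree_eq_sum]
      simp) S (fun i => hS i)
  exact ⟨s, hs, eval_starVandermonde s ▸ hne⟩

end G4'

theorem G4'_listEdgeColorable : ListEdgeColorable G4' 6 := by
  classical
  intro α L hL
  obtain ⟨φ, hφ⟩ := Set.countable_iff_exists_injOn.mp
    (univ.biUnion fun i => L (G4'.edge i)).countable_toSet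
  have hφL (i : Fin 24) : Set.InjOn (fun a => (φ a : ℤ)) (L (G4'.edge i)) :=
    Nat.cast_injective.comp_injOn
      (hφ.mono (coe_subset.mpr (subset_biUnion_of_mem (fun i => L (G4'.edge i)) (mem_univ i))))
  obtain ⟨s, hs, hne⟩ := G4'.exists_starVandermonde_ne_zero
    (fun i => (L (G4'.edge i)).image fun a => (φ a : ℤ)) fun i => by
      rw [card_image_of_injOn (hφL i)]
      exact hL _ (G4'.edge_mem_edgeSet i)
  simp only [mem_image] at hs
  choose b hbL hbs using hs
  refine ⟨Function.extend G4'.edge b fun _ => b 0, ?_, ?_⟩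
  · intro e he
    obtain ⟨i, rfl⟩ := G4'.exists_edge_eq he
    rw [G4'.edge_injective.extend_apply]
    exact hbL i
  · rintro e₁ he₁ e₂ he₂ hne' ⟨u, hu₁, hu₂⟩ heq
    obtain ⟨i, rfl⟩ := G4'.exists_edge_eq he₁
    obtain ⟨j, rfl⟩ := G4'.exists_edge_eq he₂
    rw [G4'.edge_injective.extend_apply, G4'.edge_injective.extend_apply] at heq
    obtain ⟨k, rfl⟩ := G4'.exists_star_eq hu₁
    obtain ⟨l, rfl⟩ := G4'.exists_star_eq hu₂
    have hkl : k = l := G4'.starVandermonde_ne_zero_iff.mp hne u (by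
      simp only [← hbs, heq])
    exact hne' (by rw [hkl])
end

section
/- Let G₁₆′ be the 6-regular simple graph on vertex set {0,1,...,9} with edges given by the adjacency lists: 0 ~ 1,2,3,6,8,9; 1 ~ 0,2,3,4,5,8; 2 ~ 0,1,3,5,7,8; 3 ~ 0,1,2,4,6,9; 4 ~ 1,3,5,6,7,9; 5 ~ 1,2,4,6,7,9; 6 ~ 0,3,4,5,7,8; 7 ~ 2,4,5,6,8,9; 8 ~ 0,1,2,6,7,9; 9 ~ 0,3,4,5,7,8. Then G₁₆′ is 6-list-edge-colorable. -/
/-- The 6-regular graph `G₁₆′` on 10 vertices. -/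
def G16' : SimpleGraph (Fin 10) :=
  SimpleGraph.fromEdgeSet
    {s(0, 1), s(0, 2), s(0, 3), s(0, 6), s(0, 8), s(0, 9), s(1, 2), s(1, 3), s(1, 4), s(1, 5), s(1, 8), s(2, 3), s(2, 5), s(2, 7), s(2, 8), s(3, 4), s(3, 6), s(3, 9), s(4, 5), s(4, 6), s(4, 7), s(4, 9), s(5, 6), s(5, 7), s(5, 9), s(6, 7), s(6, 8), s(7, 8), s(7, 9), s(8, 9)}

open Finset in
/-- Lagrange-interpolation formula for a top coefficient of a multivariate polynomial: the variable
`i` runs over the nodes `v t` with `t ∈ T i`. -/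
theorem MvPolynomial.sum_eval_mul_prod_inv_eq_coeff {ι κ K : Type*} [Fintype ι] [DecidableEq ι]
    [DecidableEq κ] [Field K] (f : MvPolynomial ι K) (d : ℕ)
    (hf : f.totalDegree ≤ Fintype.card ι * d) (T : ι → Finset κ) (hT : ∀ i, #(T i) = d + 1)
    (v : κ → K) (hv : ∀ i, Set.InjOn v (T i)) :
    ∑ x ∈ Fintype.piFinset T, MvPolynomial.eval (v ∘ x) f *
        ∏ i, (∏ t ∈ (T i).erase (x i), (v (x i) - v t))⁻¹
      = f.coeff (Finsupp.equivFunOnFinite.symm fun _ => d) := by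
  have power_sum (i : ι) (k : ℕ) (hk : k ≤ d) :
      ∑ s ∈ T i, v s ^ k * (∏ t ∈ (T i).erase s, (v s - v t))⁻¹ = if k = d then 1 else 0 := by
    have h := Lagrange.coeff_eq_sum (hv i) (P := (Polynomial.X : Polynomial K) ^ k)
      (by rw [Polynomial.degree_X_pow, hT]; exact_mod_cast Nat.lt_succ_of_le hk)
    rw [Polynomial.coeff_X_pow, hT, Nat.add_sub_cancel] at h
    simp only [Polynomial.eval_pow, Polynomial.eval_X, div_eq_mul_inv] at h
    rw [← h]
    simp [eq_comm]
  conv_lhs => enter [2, x]; rw [MvPolynomial.eval_eq', Finset.sum_mul]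
  rw [Finset.sum_comm]
  have monomial_sum (m : ι →₀ ℕ) (hm : m ∈ f.support) :
      ∑ x ∈ Fintype.piFinset T, f.coeff m * (∏ i, (v ∘ x) i ^ m i) *
          ∏ i, (∏ t ∈ (T i).erase (x i), (v (x i) - v t))⁻¹
        = if m = Finsupp.equivFunOnFinite.symm fun _ => d then f.coeff m else 0 := by
    simp_rw [mul_assoc, ← Finset.prod_mul_distrib, Function.comp_apply]
    rw [← Finset.mul_sum,
      ← Finset.prod_univ_sum T fun i s => v s ^ m i * (∏ t ∈ (T i).erase s, (v s - v t))⁻¹]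
    split_ifs with h
    · subst h
      simp [power_sum]
    · have hdeg : ∑ i, m i ≤ ∑ _i : ι, d := by
        have := (MvPolynomial.le_totalDegree hm).trans hf
        rw [Finsupp.sum_fintype _ _ (fun _ => rfl)] at this
        simpa using this
      obtain ⟨i, hi⟩ : ∃ i, m i < d := by
        by_contra! hge
        refine h (Finsupp.ext fun i => ?_)
        exact ((Finset.sum_eq_sum_iff_of_le fun i _ => hge i).1
          (le_antisymm (Finset.sum_le_sum fun i _ => hge i) hdeg) i (mem_univ i)).symm
      rw [Finset.prod_eq_zero (mem_univ i), mul_zero]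
      rw [power_sum i _ hi.le, if_neg hi.ne]
  rw [Finset.sum_congr rfl monomial_sum, Finset.sum_ite_eq']
  split_ifs with h
  · rfl
  · exact (MvPolynomial.notMem_support_iff.1 h).symm

/-- The sign of the comparison between two colors. -/
def orderSign (a b : ℕ) : ℤ := if a < b then 1 else if b < a then -1 else 0

/-- The sign of a map if it is a permutation, and `0` otherwise. -/
def mapSign {n : ℕ} (p : Fin n → Fin n) : ℤ := ∏ i, ∏ j ∈ Finset.Ioi i, orderSign (p i) (p j)

theorem mapSign_perm {n : ℕ} (σ : Equiv.Perm (Fin n)) : mapSign σ = (Equiv.Perm.sign σ : ℤ) := by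
  rw [Equiv.Perm.sign_eq_prod_prod_Ioi, mapSign]
  push_cast
  refine Finset.prod_congr rfl fun i _ => Finset.prod_congr rfl fun j hj => ?_
  have hij : σ i ≠ σ j := σ.injective.ne (Finset.mem_Ioi.1 hj).ne
  unfold orderSign
  rcases lt_or_gt_of_ne hij with h | h
  · simp [h]
  · simp [h, h.not_gt]

theorem bijective_of_mapSign_ne_zero {n : ℕ} {p : Fin n → Fin n} (h : mapSign p ≠ 0) :
    Function.Bijective p := by
  refine Finite.injective_iff_bijective.1 ?_
  have key (i j : Fin n) (hij : i < j) : p i ≠ p j := fun he => by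
    have := Finset.prod_ne_zero_iff.1 (Finset.prod_ne_zero_iff.1 h i (Finset.mem_univ i)) j
      (Finset.mem_Ioi.2 hij)
    simp [orderSign, he] at this
  intro i j he
  by_contra hne
  rcases lt_or_gt_of_ne hne with hij | hij
  · exact key i j hij he
  · exact key j i hij he.symm

theorem mapSign_perm_comp {n : ℕ} (τ : Equiv.Perm (Fin n)) (p : Fin n → Fin n) :
    mapSign (τ ∘ p) = Equiv.Perm.sign τ * mapSign p := by
  by_cases hp : Function.Bijective p
  · have h := mapSign_perm (τ * Equiv.ofBijective p hp)
    have h' := mapSign_perm (Equiv.ofBijective p hp)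
    simp only [Equiv.Perm.coe_mul, Equiv.Perm.sign_mul,
      Units.val_mul] at h
    rw [← h'] at h
    exact h
  · have h1 : mapSign p = 0 := not_not.1 (mt bijective_of_mapSign_ne_zero hp)
    have h2 : mapSign (τ ∘ p) = 0 := by
      refine not_not.1 (mt bijective_of_mapSign_ne_zero fun h => hp ?_)
      exact (Function.Bijective.of_comp_iff' τ.bijective p).1 h
    rw [h1, h2, mul_zero]

theorem Matrix.det_vandermonde_comp {n : ℕ} {K : Type*} [Field K] (s : Fin n → K)
    (p : Fin n → Fin n) :
    (Matrix.vandermonde (s ∘ p)).det = mapSign p * (Matrix.vandermonde s).det := by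
  by_cases hp : Function.Bijective p
  · have h := Matrix.det_permute (Equiv.ofBijective p hp) (Matrix.vandermonde s)
    have h' := congrArg (Int.cast : ℤ → K) (mapSign_perm (Equiv.ofBijective p hp))
    exact h.trans (congrArg (· * _) h'.symm)
  · have h1 : mapSign p = 0 := not_not.1 (mt bijective_of_mapSign_ne_zero hp)
    rw [h1, Int.cast_zero, zero_mul]
    rw [← Finite.injective_iff_bijective] at hp
    exact Matrix.det_vandermonde_eq_zero_iff.2 (by
      simp only [Function.Injective, not_forall] at hp
      obtain ⟨i, j, h, hne⟩ := hp
      exact ⟨i, j, congrArg s h, hne⟩)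

/-- The edges of `G16'`, each with a bit mask of the colors it may not get. The edges at vertex `3`
come first, and the masks color them `0, …, 5` in this order. -/
def edgeData : List (Fin 10 × Fin 10 × ℕ) :=
  [(2, 3, 62), (0, 3, 61), (3, 6, 59), (3, 4, 55), (1, 3, 47), (3, 9, 31),
    (1, 4, 0), (4, 9, 0), (4, 6, 0), (4, 7, 0), (4, 5, 0), (1, 5, 0),
    (5, 6, 0), (5, 9, 0), (5, 7, 0), (2, 5, 0), (6, 7, 0), (7, 9, 0),
    (2, 7, 0), (7, 8, 0), (6, 8, 0), (8, 9, 0), (1, 8, 0), (2, 8, 0),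
    (1, 2, 0), (0, 8, 0), (0, 2, 0), (0, 1, 0), (0, 9, 0), (0, 6, 0)]

/-- The indices in `edgeData` of the edges at a vertex, in increasing order. -/
def incidence : Fin 10 → Fin 6 → Fin 30 :=
  ![![1, 25, 26, 27, 28, 29],
    ![4, 6, 11, 22, 24, 27],
    ![0, 15, 18, 23, 24, 26],
    ![0, 1, 2, 3, 4, 5],
    ![3, 6, 7, 8, 9, 10],
    ![10, 11, 12, 13, 14, 15],
    ![2, 8, 12, 16, 20, 29],
    ![9, 14, 16, 17, 18, 19],
    ![19, 20, 21, 22, 23, 25],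
    ![5, 7, 13, 17, 21, 28]]

/-- `f n`, arranged so that kernel reduction evaluates `n` to a numeral first. -/
def forceNat (n : ℕ) (f : ℕ → ℕ) : ℕ :=
  Nat.rec (f 0) (fun m _ => f (Nat.succ m)) n

theorem forceNat_eq (n : ℕ) (f : ℕ → ℕ) : forceNat n f = f n := by
  cases n <;> rfl

/-- The contribution of the color `c` to `signedCount`. -/
def colorBranch (next : ℕ → ℕ) (state pos used par c : ℕ) : ℕ :=
  bif Nat.beq (Nat.land used (Nat.pow 2 c)) 0 then
    Nat.mul (bif Nat.beq (Nat.land par (Nat.pow 2 (Nat.add 6 c))) 0 then 1 else 6)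
      (forceNat (Nat.xor state (Nat.mul (Nat.sub (Nat.mul 65 (Nat.pow 2 c)) 64) pos)) next)
  else 0

/-- Backtracking evaluation, modulo `7`, of the signed number of proper colorings of a list of
edges. The state has twelve bits for each vertex: six mark the colors that are used there, and six
hold, for each color, the parity of the number of larger used colors. -/
def signedCount : List (Fin 10 × Fin 10 × ℕ) → ℕ → ℕ
  | [], _ => 1
  | (u, v, forbidden) :: es, state =>
    forceNat (Nat.shiftRight state (Nat.mul 12 u)) fun su =>
    forceNat (Nat.shiftRight state (Nat.mul 12 v)) fun sv =>
    forceNat (Nat.lor forbidden (Nat.lor su sv)) fun used =>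
    forceNat (Nat.xor su sv) fun par =>
    forceNat (Nat.add (Nat.pow 2 (Nat.mul 12 u)) (Nat.pow 2 (Nat.mul 12 v))) fun pos =>
    let branch := colorBranch (signedCount es) state pos used par
    Nat.add (branch 0) (Nat.add (branch 1) (Nat.add (branch 2)
      (Nat.add (branch 3) (Nat.add (branch 4) (branch 5)))))

/-- The sign with which a color can be added at a vertex, `0` if it is used there. -/
def stateSign (state : ℕ) (w : Fin 10) (c : Fin 6) : ℤ :=
  if state.testBit (12 * w + c) then 0 else if state.testBit (12 * w + (6 + c)) then -1 else 1

/-- The signs after an edge `uv` has been colored `c`. -/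
def updateSign (s : Fin 10 → Fin 6 → ℤ) (u v : Fin 10) (c : Fin 6) : Fin 10 → Fin 6 → ℤ :=
  fun w d => if w = u ∨ w = v then s w d * orderSign c d else s w d

/-- The recursion behind `signedCount`, on the signs instead of their binary encoding. -/
def colorSum : List (Fin 10 × Fin 10 × ℕ) → (Fin 10 → Fin 6 → ℤ) → ℤ
  | [], _ => 1
  | (u, v, forbidden) :: es, s =>
    ∑ c : Fin 6, if forbidden.testBit c then 0 else s u c * s v c * colorSum es (updateSign s u v c)

theorem beq_land_two_pow (n i : ℕ) : Nat.beq (Nat.land n (Nat.pow 2 i)) 0 = !n.testBit i := by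
  have h : Nat.land n (Nat.pow 2 i) = 2 ^ i * (n.testBit i).toNat :=
    (Nat.and_two_pow n i).trans (mul_comm _ _)
  rw [h]
  cases n.testBit i
  · simp
  · have : 2 ^ i ≠ 0 := by positivity
    rw [Bool.toNat_true, mul_one, Bool.not_true, ← Bool.not_eq_true, Nat.beq_eq]
    exact this

theorem stateSign_xor {state : ℕ} {u v : Fin 10} {c : Fin 6} (huv : u ≠ v)
    (hu : state.testBit (12 * u + c) = false) (hv : state.testBit (12 * v + c) = false) :
    stateSign (state ^^^ (65 * 2 ^ (c : ℕ) - 64) * (2 ^ (12 * (u : ℕ)) + 2 ^ (12 * (v : ℕ)))) =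
      updateSign (stateSign state) u v c := by
  have bits : ∀ u v w : Fin 10, u ≠ v → ∀ c d : Fin 6,
      (((65 * 2 ^ (c : ℕ) - 64) * (2 ^ (12 * (u : ℕ)) + 2 ^ (12 * (v : ℕ)))).testBit (12 * w + d)
        = decide ((w = u ∨ w = v) ∧ d = c)) ∧
      (((65 * 2 ^ (c : ℕ) - 64) * (2 ^ (12 * (u : ℕ)) + 2 ^ (12 * (v : ℕ)))).testBit
        (12 * w + (6 + d)) = decide ((w = u ∨ w = v) ∧ d < c)) := by
    decide +kernel
  funext w d
  obtain ⟨h1, h2⟩ := bits u v w huv c d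
  simp only [stateSign, updateSign, Nat.testBit_xor, h1, h2]
  by_cases hw : w = u ∨ w = v
  · have hc : state.testBit (12 * w + c) = false := by rcases hw with rfl | rfl <;> assumption
    rcases lt_trichotomy d c with h | h | h
    · cases state.testBit (12 * w + d) <;> cases state.testBit (12 * w + (6 + d)) <;>
        simp [hw, h, h.ne, orderSign, h.not_gt]
    · subst h
      simp [hw, hc, orderSign]
    · simp [hw, h.ne', orderSign, h.not_gt, h]
  · simp [hw]

theorem colorBranch_cast {es : List (Fin 10 × Fin 10 × ℕ)} {state : ℕ} {u v : Fin 10}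
    (huv : u ≠ v) (forbidden : ℕ) (c : Fin 6)
    (ih : ∀ state, (signedCount es state : ZMod 7) = (colorSum es (stateSign state) : ℤ)) :
    (colorBranch (signedCount es) state
      (Nat.add (Nat.pow 2 (Nat.mul 12 u)) (Nat.pow 2 (Nat.mul 12 v)))
      (Nat.lor forbidden (Nat.lor (Nat.shiftRight state (Nat.mul 12 u))
        (Nat.shiftRight state (Nat.mul 12 v))))
      (Nat.xor (Nat.shiftRight state (Nat.mul 12 u)) (Nat.shiftRight state (Nat.mul 12 v))) c :
        ZMod 7) =
      ((if forbidden.testBit c then 0 else stateSign state u c * stateSign state v c *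
        colorSum es (updateSign (stateSign state) u v c) : ℤ) : ZMod 7) := by
  have hused : (Nat.lor forbidden (Nat.lor (Nat.shiftRight state (Nat.mul 12 u))
      (Nat.shiftRight state (Nat.mul 12 v)))).testBit c = (forbidden.testBit c ||
        (state.testBit (12 * u + c) || state.testBit (12 * v + c))) := by
    change (forbidden ||| (state >>> (12 * u : ℕ) ||| state >>> (12 * v : ℕ))).testBit c = _
    simp [Nat.testBit_or, Nat.testBit_shiftRight]
  have hpar : (Nat.xor (Nat.shiftRight state (Nat.mul 12 u))
      (Nat.shiftRight state (Nat.mul 12 v))).testBit (Nat.add 6 c) =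
        (state.testBit (12 * u + (6 + c)) ^^ state.testBit (12 * v + (6 + c))) := by
    change (state >>> (12 * u : ℕ) ^^^ state >>> (12 * v : ℕ)).testBit (6 + c) = _
    simp [Nat.testBit_xor, Nat.testBit_shiftRight]
  have neg_one : (6 : ZMod 7) = -1 := by decide
  unfold colorBranch
  rw [forceNat_eq, beq_land_two_pow, beq_land_two_pow, hused, hpar]
  by_cases hf : forbidden.testBit c
  · simp [hf]
  by_cases hu : state.testBit (12 * u + c)
  · simp [hu, stateSign]
  by_cases hv : state.testBit (12 * v + c)
  · simp [hv, stateSign]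
  rw [Bool.not_eq_true] at hf hu hv
  rw [← stateSign_xor huv hu hv]
  have hnext := ih (state ^^^ (65 * 2 ^ (c : ℕ) - 64) * (2 ^ (12 * (u : ℕ)) + 2 ^ (12 * (v : ℕ))))
  change ((signedCount es (Nat.xor state (Nat.mul (Nat.sub (Nat.mul 65 (Nat.pow 2 c)) 64)
    (Nat.add (Nat.pow 2 (Nat.mul 12 u)) (Nat.pow 2 (Nat.mul 12 v))))) : ℕ) : ZMod 7) = _ at hnext
  simp only [hf, hu, hv, stateSign, Bool.or_false, Bool.not_false, cond_true, Nat.mul_eq,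
    Nat.cast_mul, Bool.false_eq_true, if_false, Int.cast_mul] at hnext ⊢
  rw [hnext]
  cases state.testBit (12 * u + (6 + c)) <;> cases state.testBit (12 * v + (6 + c)) <;>
    simp [neg_one]

theorem signedCount_cast (es : List (Fin 10 × Fin 10 × ℕ)) (hes : ∀ e ∈ es, e.1 ≠ e.2.1)
    (state : ℕ) : (signedCount es state : ZMod 7) = (colorSum es (stateSign state) : ℤ) := by
  induction es generalizing state with
  | nil => simp [signedCount, colorSum]
  | cons e es ih =>
    obtain ⟨u, v, forbidden⟩ := e
    have huv : u ≠ v := hes _ List.mem_cons_self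
    have branch := colorBranch_cast (state := state) huv forbidden
      (ih := ih fun e he => hes e (List.mem_cons_of_mem _ he))
    simp only [signedCount, colorSum, forceNat_eq, Nat.add_eq, Nat.cast_add, Int.cast_sum]
    rw [Finset.sum_congr rfl fun c _ => (branch c).symm, Fin.sum_univ_six]
    simp only [Fin.val_zero, Fin.val_one]
    simp only [add_assoc]
    rfl

/-- The sign contributed by the vertex `w` to a coloring of a list of edges, where `t` holds the
signs of the colors at `w`. -/
def vertexSign (w : Fin 10) : (es : List (Fin 10 × Fin 10 × ℕ)) → (Fin 6 → ℤ) →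
    (Fin es.length → Fin 6) → ℤ
  | [], _, _ => 1
  | (u, v, _) :: es, t, x =>
    if w = u ∨ w = v then
      t (x 0) * vertexSign w es (fun d => t d * orderSign (x 0) d) (Fin.tail x)
    else vertexSign w es t (Fin.tail x)

theorem prod_vertexSign_cons {u v : Fin 10} (huv : u ≠ v) (forbidden : ℕ)
    (es : List (Fin 10 × Fin 10 × ℕ)) (s : Fin 10 → Fin 6 → ℤ) (c : Fin 6)
    (x : Fin es.length → Fin 6) :
    ∏ w, vertexSign w ((u, v, forbidden) :: es) (s w)
        (Fin.cons (α := fun _ => Fin 6) c x : Fin (es.length + 1) → Fin 6) =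
      s u c * s v c * ∏ w, vertexSign w es (updateSign s u v c w) x := by
  have split (w : Fin 10) : vertexSign w ((u, v, forbidden) :: es) (s w)
      (Fin.cons (α := fun _ => Fin 6) c x : Fin (es.length + 1) → Fin 6) =
      ((if w = u then s u c else 1) * (if w = v then s v c else 1)) *
        vertexSign w es (updateSign s u v c w) x := by
    rw [vertexSign]
    unfold updateSign
    by_cases hu : w = u
    · subst hu
      simp [huv]
    · by_cases hv : w = v
      · subst hv
        simp [huv.symm]
      · simp [hu, hv]
  simp only [split, Finset.prod_mul_distrib, Finset.prod_ite_eq', Finset.mem_univ, if_true]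

theorem colorSum_eq_sum (es : List (Fin 10 × Fin 10 × ℕ)) (hes : ∀ e ∈ es, e.1 ≠ e.2.1)
    (s : Fin 10 → Fin 6 → ℤ) :
    colorSum es s = ∑ x : Fin es.length → Fin 6,
      if ∀ i, (es.get i).2.2.testBit (x i) = false then ∏ w, vertexSign w es (s w) x else 0 := by
  induction es generalizing s with
  | nil => simp [colorSum, vertexSign]
  | cons e es ih =>
    obtain ⟨u, v, forbidden⟩ := e
    have huv : u ≠ v := hes _ List.mem_cons_self
    refine Eq.trans ?_ ((Fin.consEquiv (n := es.length) fun _ => Fin 6).sum_comp _)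
    rw [Fintype.sum_prod_type, colorSum]
    refine Finset.sum_congr rfl fun c _ => ?_
    rw [ih fun e he => hes e (List.mem_cons_of_mem _ he)]
    have step (x : Fin es.length → Fin 6) := prod_vertexSign_cons huv forbidden es s c x
    by_cases hf : forbidden.testBit c
    · rw [if_pos hf]
      refine (Finset.sum_eq_zero fun x _ => if_neg fun h => ?_).symm
      simpa [hf] using h 0
    · rw [if_neg hf, Finset.mul_sum]
      refine Finset.sum_congr rfl fun x _ => ?_
      rw [mul_ite, mul_zero, ← step]
      refine if_congr ?_ rfl rfl
      refine Iff.trans ?_ (Fin.forall_fin_succ (n := es.length)).symm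
      simp [Fin.consEquiv, hf]

theorem mapSign_six (p : Fin 6 → Fin 6) :
    mapSign p = 1 * (1 * orderSign (p 0) (p 1) * (1 * orderSign (p 0) (p 2) * orderSign (p 1) (p 2) *
      (1 * orderSign (p 0) (p 3) * orderSign (p 1) (p 3) * orderSign (p 2) (p 3) *
      (1 * orderSign (p 0) (p 4) * orderSign (p 1) (p 4) * orderSign (p 2) (p 4) *
        orderSign (p 3) (p 4) *
      (1 * orderSign (p 0) (p 5) * orderSign (p 1) (p 5) * orderSign (p 2) (p 5) *
        orderSign (p 3) (p 5) * orderSign (p 4) (p 5) * 1))))) := by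
  rw [mapSign, Finset.prod_comm' (t' := Finset.univ) (s' := Finset.Iio) (by simp),
    Fin.prod_univ_six]
  have h0 : Finset.Iio (0 : Fin 6) = ∅ := by decide
  have h1 : Finset.Iio (1 : Fin 6) = {0} := by decide
  have h2 : Finset.Iio (2 : Fin 6) = {0, 1} := by decide
  have h3 : Finset.Iio (3 : Fin 6) = {0, 1, 2} := by decide
  have h4 : Finset.Iio (4 : Fin 6) = {0, 1, 2, 3} := by decide
  have h5 : Finset.Iio (5 : Fin 6) = {0, 1, 2, 3, 4} := by decide
  rw [h0, h1, h2, h3, h4, h5]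
  simp [mul_assoc]

theorem vertexSign_edgeData (w : Fin 10) (x : Fin 30 → Fin 6) :
    vertexSign w edgeData (fun _ => 1) x = mapSign (x ∘ incidence w) := by
  rw [mapSign_six]
  fin_cases w <;> rfl

theorem sum_normalized_ne_zero :
    (∑ x : Fin 30 → Fin 6,
      if x ∘ incidence 3 = id then ∏ w, mapSign (x ∘ incidence w) else 0) ≠ 0 := by
  have hcount : signedCount edgeData 0 % 7 ≠ 0 := by decide +kernel
  have hne : ∀ e ∈ edgeData, e.1 ≠ e.2.1 := by decide
  intro h
  refine hcount (Nat.mod_eq_zero_of_dvd ((ZMod.natCast_eq_zero_iff _ 7).1 ?_))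
  have hs : stateSign 0 = fun _ _ => 1 := by
    funext w c
    simp [stateSign]
  have hmask (x : Fin 30 → Fin 6) :
      (∀ i : Fin 30, (edgeData.get i).2.2.testBit (x i) = false) ↔ x ∘ incidence 3 = id := by
    have mask_first : ∀ (j c : Fin 6),
        (edgeData.get (incidence 3 j)).2.2.testBit c = false ↔ c = j := by decide
    have mask_rest : ∀ i : Fin 30, (∃ j, incidence 3 j = i) ∨ (edgeData.get i).2.2 = 0 := by decide
    refine ⟨fun hx => funext fun j => (mask_first j _).1 (hx _), fun hx i => ?_⟩
    rcases mask_rest i with ⟨j, rfl⟩ | hi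
    · exact (mask_first j _).2 (congrFun hx j)
    · rw [hi, Nat.zero_testBit]
  have hsum : colorSum edgeData (fun _ _ => 1) = ∑ x : Fin 30 → Fin 6,
      if ∀ i : Fin 30, (edgeData.get i).2.2.testBit (x i) = false then
        ∏ w, vertexSign w edgeData (fun _ => 1) x else 0 :=
    colorSum_eq_sum edgeData hne _
  simp only [vertexSign_edgeData, hmask, h] at hsum
  rw [signedCount_cast _ hne, hs, hsum, Int.cast_zero]

theorem sum_prod_mapSign_ne_zero :
    ∑ x : Fin 30 → Fin 6, ∏ w, mapSign (x ∘ incidence w) ≠ 0 := by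
  have relabel (τ : Equiv.Perm (Fin 6)) (x : Fin 30 → Fin 6) :
      ∏ w, mapSign ((τ ∘ x) ∘ incidence w) = ∏ w, mapSign (x ∘ incidence w) := by
    have hsq : (Equiv.Perm.sign τ : ℤ) ^ 10 = 1 := by
      rcases Int.units_eq_one_or (Equiv.Perm.sign τ) with h | h <;> simp [h]
    simp [Function.comp_assoc, mapSign_perm_comp, Finset.prod_mul_distrib, hsq]
  have fiber (x : Fin 30 → Fin 6) : ∏ w, mapSign (x ∘ incidence w) =
      ∑ τ : Equiv.Perm (Fin 6),
        if x ∘ incidence 3 = τ then ∏ w, mapSign (x ∘ incidence w) else 0 := by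
    by_cases hx : Function.Bijective (x ∘ incidence 3)
    · have hne (τ : Equiv.Perm (Fin 6)) (hτ : τ ≠ Equiv.ofBijective _ hx) :
          ¬ x ∘ incidence 3 = τ := fun h => hτ (Equiv.ext fun i => (congrFun h i).symm)
      rw [Finset.sum_eq_single (Equiv.ofBijective _ hx) (fun τ _ hτ => if_neg (hne τ hτ))
        (fun h => absurd (Finset.mem_univ _) h)]
      exact (if_pos rfl).symm
    · have hzero : ∏ w, mapSign (x ∘ incidence w) = 0 :=
        Finset.prod_eq_zero (Finset.mem_univ 3) (not_not.1 (mt bijective_of_mapSign_ne_zero hx))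
      simp [hzero]
  have fiber_sum (τ : Equiv.Perm (Fin 6)) :
      (∑ x : Fin 30 → Fin 6,
        if x ∘ incidence 3 = τ then ∏ w, mapSign (x ∘ incidence w) else 0) =
      ∑ x : Fin 30 → Fin 6,
        if x ∘ incidence 3 = id then ∏ w, mapSign (x ∘ incidence w) else 0 := by
    refine ((Equiv.arrowCongr (Equiv.refl (Fin 30)) τ).sum_comp _).symm.trans ?_
    refine Finset.sum_congr rfl fun x _ => if_congr ?_ (relabel τ x) rfl
    change τ ∘ (x ∘ incidence 3) = τ ∘ id ↔ _
    exact τ.injective.comp_left.eq_iff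
  rw [Finset.sum_congr rfl fun x _ => fiber x, Finset.sum_comm,
    Finset.sum_congr rfl fun τ _ => fiber_sum τ, Finset.sum_const]
  exact smul_ne_zero (by simp) sum_normalized_ne_zero

theorem sum_incidence (h : Fin 30 → ℕ) : ∑ w, ∑ i, h (incidence w i) = 2 * ∑ k, h k := by
  have hcard : ∀ k,
      (Finset.univ.filter fun p : Fin 10 × Fin 6 => incidence p.1 p.2 = k).card = 2 := by
    decide +kernel
  rw [← Fintype.sum_prod_type',
    ← Finset.sum_fiberwise _ fun p : Fin 10 × Fin 6 => incidence p.1 p.2, Finset.mul_sum]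
  refine Finset.sum_congr rfl fun k _ => ?_
  rw [Finset.sum_congr rfl fun p hp => congrArg h (Finset.mem_filter.1 hp).2, Finset.sum_const,
    hcard, smul_eq_mul]

theorem prod_color_weight {M : Type*} [CommMonoid M] (weight : Fin 6 → M) {x : Fin 30 → Fin 6}
    (hx : ∀ w, Function.Bijective (x ∘ incidence w)) :
    ∏ k, weight (x k) = (∏ c, weight c) ^ 5 := by
  have class_card (c : Fin 6) : (Finset.univ.filter fun k => x k = c).card = 5 := by
    have h := sum_incidence fun k => if x k = c then 1 else 0
    have hw (w : Fin 10) : ∑ i, (if x (incidence w i) = c then 1 else 0) = 1 := by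
      refine ((hx w).sum_comp fun d => if d = c then 1 else 0).trans ?_
      simp
    rw [Finset.sum_congr rfl fun w _ => hw w, ← Finset.card_filter] at h
    simp at h
    omega
  rw [← Finset.prod_fiberwise _ x, ← Finset.prod_pow]
  refine Finset.prod_congr rfl fun c _ => ?_
  rw [Finset.prod_congr rfl fun k hk => congrArg weight (Finset.mem_filter.1 hk).2,
    Finset.prod_const, class_card]

/-- The product of the Vandermonde determinants at the vertices, with a variable for each edge. -/
noncomputable def edgePolynomial : MvPolynomial (Fin 30) ℚ :=
  ∏ w, (Matrix.vandermonde fun i => MvPolynomial.X (incidence w i)).det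

theorem eval_edgePolynomial (x : Fin 30 → ℚ) :
    MvPolynomial.eval x edgePolynomial = ∏ w, (Matrix.vandermonde (x ∘ incidence w)).det := by
  simp [edgePolynomial, Matrix.det_vandermonde]

theorem totalDegree_edgePolynomial_le : edgePolynomial.totalDegree ≤ Fintype.card (Fin 30) * 5 := by
  have vertex_degree (w : Fin 10) : (Matrix.vandermonde fun i =>
      (MvPolynomial.X (incidence w i) : MvPolynomial (Fin 30) ℚ)).det.totalDegree ≤ 15 := by
    rw [Matrix.det_vandermonde]
    calc _ ≤ ∑ i : Fin 6, ∑ j ∈ Finset.Ioi i, 1 := by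
          refine (MvPolynomial.totalDegree_finsetProd _ _).trans (Finset.sum_le_sum fun i _ => ?_)
          refine (MvPolynomial.totalDegree_finsetProd _ _).trans (Finset.sum_le_sum fun j _ => ?_)
          refine (MvPolynomial.totalDegree_sub _ _).trans ?_
          simp
      _ = 15 := by decide
  refine (MvPolynomial.totalDegree_finsetProd _ _).trans ?_
  exact (Finset.sum_le_sum fun w _ => vertex_degree w).trans (by simp)

theorem coeff_edgePolynomial_ne_zero :
    edgePolynomial.coeff (Finsupp.equivFunOnFinite.symm fun _ => 5) ≠ 0 := by
  let node : Fin 6 → ℚ := fun c => (c : ℕ)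
  have hnode : Function.Injective node := Nat.cast_injective.comp Fin.val_injective
  let weight : Fin 6 → ℚ := fun c => (∏ t ∈ Finset.univ.erase c, (node c - node t))⁻¹
  have hweight : ∏ c, weight c ≠ 0 := by
    refine Finset.prod_ne_zero_iff.2 fun c _ => inv_ne_zero (Finset.prod_ne_zero_iff.2 fun t ht => ?_)
    exact sub_ne_zero.2 (hnode.ne (Finset.ne_of_mem_erase ht).symm)
  have hdet := Matrix.det_vandermonde_ne_zero_iff.2 hnode
  have hterm (x : Fin 30 → Fin 6) :
      MvPolynomial.eval (node ∘ x) edgePolynomial * ∏ k, weight (x k) =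
        ((∏ w, mapSign (x ∘ incidence w) : ℤ) : ℚ) *
          ((Matrix.vandermonde node).det ^ 10 * (∏ c, weight c) ^ 5) := by
    simp only [eval_edgePolynomial, Function.comp_assoc, Matrix.det_vandermonde_comp,
      Finset.prod_mul_distrib, Finset.prod_const, Finset.card_univ, Fintype.card_fin]
    rw [Int.cast_prod]
    by_cases h : ∏ w, mapSign (x ∘ incidence w) = 0
    · rw [← Int.cast_prod, h]
      simp
    · rw [prod_color_weight weight fun w =>
        bijective_of_mapSign_ne_zero (Finset.prod_ne_zero_iff.1 h w (Finset.mem_univ w)), mul_assoc]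
  rw [← MvPolynomial.sum_eval_mul_prod_inv_eq_coeff edgePolynomial 5 totalDegree_edgePolynomial_le
    (fun _ => Finset.univ) (fun _ => rfl) node fun _ => hnode.injOn, Fintype.piFinset_univ,
    Finset.sum_congr rfl fun x _ => hterm x, ← Finset.sum_mul, ← Int.cast_sum]
  exact mul_ne_zero (Int.cast_ne_zero.2 sum_prod_mapSign_ne_zero)
    (mul_ne_zero (pow_ne_zero _ hdet) (pow_ne_zero _ hweight))

theorem exists_injective_at_vertices {α : Type*} (T : Fin 30 → Finset α)
    (hT : ∀ k, (T k).card = 6) :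
    ∃ y : Fin 30 → α, (∀ k, y k ∈ T k) ∧ ∀ w, Function.Injective (y ∘ incidence w) := by
  classical
  obtain ⟨v, hv⟩ : ∃ v : α → ℕ, Set.InjOn v (Finset.univ.biUnion T) :=
    Set.countable_iff_exists_injOn.1 (Finset.countable_toSet _)
  have h := MvPolynomial.sum_eval_mul_prod_inv_eq_coeff edgePolynomial 5
    totalDegree_edgePolynomial_le T hT (fun a => (v a : ℚ)) fun k a ha b hb hab =>
      hv (Finset.mem_biUnion.2 ⟨k, Finset.mem_univ k, ha⟩)
        (Finset.mem_biUnion.2 ⟨k, Finset.mem_univ k, hb⟩) (Nat.cast_injective hab)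
  obtain ⟨y, hy, hne⟩ := Finset.exists_ne_zero_of_sum_ne_zero (h ▸ coeff_edgePolynomial_ne_zero)
  refine ⟨y, Fintype.mem_piFinset.1 hy, fun w => ?_⟩
  have hw := left_ne_zero_of_mul hne
  rw [eval_edgePolynomial] at hw
  have hdet := Finset.prod_ne_zero_iff.1 hw w (Finset.mem_univ w)
  exact (Matrix.det_vandermonde_ne_zero_iff.1 hdet).of_comp (f := fun a => (v a : ℚ))

/-- The edge with a given index in `edgeData`. -/
def indexedEdge (k : Fin 30) : Sym2 (Fin 10) := s((edgeData.get k).1, (edgeData.get k).2.1)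

theorem indexedEdge_injective : Function.Injective indexedEdge := by
  unfold Function.Injective
  decide +kernel

theorem indexedEdge_mem (k : Fin 30) : indexedEdge k ∈ G16'.edgeSet := by
  simp only [G16', SimpleGraph.edgeSet_fromEdgeSet, Set.mem_sdiff, Set.mem_insert_iff,
    Set.mem_singleton_iff]
  revert k
  decide +kernel

theorem exists_indexedEdge_eq {e : Sym2 (Fin 10)} (he : e ∈ G16'.edgeSet) :
    ∃ k, indexedEdge k = e := by
  simp only [G16', SimpleGraph.edgeSet_fromEdgeSet, Set.mem_sdiff, Set.mem_insert_iff,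
    Set.mem_singleton_iff] at he
  revert e
  decide +kernel

theorem exists_incidence_eq :
    ∀ (w : Fin 10) (k : Fin 30), w ∈ indexedEdge k → ∃ i, incidence w i = k := by
  decide +kernel

theorem G16'_listEdgeColorable : ListEdgeColorable G16' 6 := by
  intro α L hL
  choose T hTL hT using fun k => Finset.exists_subset_card_eq (hL _ (indexedEdge_mem k))
  obtain ⟨y, hyT, hy⟩ := exists_injective_at_vertices T hT
  have hc := indexedEdge_injective.extend_apply y fun _ => y 0
  refine ⟨Function.extend indexedEdge y fun _ => y 0, fun e he => ?_, ?_⟩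
  · obtain ⟨k, rfl⟩ := exists_indexedEdge_eq he
    rw [hc]
    exact hTL k (hyT k)
  · rintro e₁ he₁ e₂ he₂ hne ⟨w, hw₁, hw₂⟩
    obtain ⟨k₁, rfl⟩ := exists_indexedEdge_eq he₁
    obtain ⟨k₂, rfl⟩ := exists_indexedEdge_eq he₂
    obtain ⟨i, rfl⟩ := exists_incidence_eq w k₁ hw₁
    obtain ⟨j, rfl⟩ := exists_incidence_eq w k₂ hw₂
    rw [hc, hc]
    exact fun h => hne (congrArg (indexedEdge ∘ incidence w) (hy w h))
end
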